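/- arXiv:2203.06075 — 11 statements merged into one kernel-verified Lean document; each statement's English description precedes it below -/
import Mathlib

section
/- Let A be an alphabet, n, k, s : ℕ, and let L be a set of words of length n over A. Let C be an (s,k)-Σ₂-circuit on words of length n over A such that every word of L satisfies C. Suppose there is a finite subset L' of L such that every finite subset F of L' with s·|F| ≥ |L'| admits a k-limit for F that does not belong to L. Then C accepts some word outside of L, i.e., there exists a word w of length n with C w and w ∉ L. -/
/-- A predicate on words (functions `ι → A`) is `k`-local if its value is
determined by the letters at some fixed set of at most `k` positions. -/
def KLocal {ι A : Type*} (k : ℕ) (g : (ι → A) → Prop) : Prop :=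
  ∃ P : Finset ι, P.card ≤ k ∧ ∀ w v : ι → A, (∀ p ∈ P, w p = v p) → (g w ↔ g v)

/-- An `(s,k)`-Σ₂-circuit: an OR of at most `s` ANDs of `k`-local predicates. -/
def Sigma2Circuit {ι A : Type*} (s k : ℕ) (C : (ι → A) → Prop) : Prop :=
  ∃ s' : ℕ, s' ≤ s ∧ ∃ J : Fin s' → Type, ∃ g : ∀ i : Fin s', J i → ((ι → A) → Prop),
    (∀ i j, KLocal k (g i j)) ∧ ∀ w, C w ↔ ∃ i, ∀ j, g i j w

/-- `u` is a `k`-limit for `F`: any `k` positions of `u` are matched by some word of `F`. -/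
def KLimit {ι A : Type*} (k : ℕ) (F : Set (ι → A)) (u : ι → A) : Prop :=
  ∀ P : Finset ι, P.card ≤ k → ∃ v ∈ F, ∀ p ∈ P, u p = v p

/-- A language is recognized by a Σ₂ circuit family:
polynomial-size Σ₂ circuits with constant top fan-in (locality). -/
def RecSigma2 {A : Type*} (L : Language A) : Prop :=
  ∃ k c d : ℕ, ∀ n : ℕ, ∃ C : (Fin n → A) → Prop,
    Sigma2Circuit (c * (n + 1) ^ d) k C ∧ ∀ w : Fin n → A, C w ↔ List.ofFn w ∈ L

/-- If a `Σ₂` circuit `C` of size `s` and top fan-in `k` accepts all words of `L`,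
and some finite `L' ⊆ L` is such that every sufficiently large `F ⊆ L'` has a
`k`-limit outside `L`, then `C` accepts a word outside `L`. -/
theorem sigma2_circuit_accepts_outside {A : Type*} {n k s : ℕ}
    (L : Set (Fin n → A)) (C : (Fin n → A) → Prop)
    (hC : Sigma2Circuit s k C) (hL : ∀ w ∈ L, C w)
    (L' : Finset (Fin n → A)) (hL'sub : ↑L' ⊆ L)
    (hlim : ∀ F : Finset (Fin n → A), F ⊆ L' → s * F.card ≥ L'.card →
      ∃ u : Fin n → A, KLimit k (↑F) u ∧ u ∉ L) :
    ∃ w : Fin n → A, C w ∧ w ∉ L := by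
  classical
  obtain ⟨s', hs', J, g, hg, hCg⟩ := hC
  obtain ⟨i, hi⟩ : ∃ i : Fin s', L'.card ≤ s * (L'.filter fun w => ∀ j, g i j w).card := by
    have hne : L'.Nonempty := by
      by_contra h
      rw [Finset.not_nonempty_iff_eq_empty] at h
      obtain ⟨u, hu, -⟩ := hlim ∅ (Finset.empty_subset _) (by simp [h])
      obtain ⟨v, hv, -⟩ := hu ∅ (by simp)
      simp at hv
    have hcover : ∀ w ∈ L', ∃ i, ∀ j, g i j w := fun w hw => (hCg w).1 (hL w (hL'sub hw))
    obtain ⟨w, hw⟩ := hne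
    obtain ⟨i₀, -⟩ := hcover w hw
    have hcard : L'.card ≤ ∑ i : Fin s', (L'.filter fun w => ∀ j, g i j w).card := by
      refine le_trans (Finset.card_le_card fun w hw => ?_) Finset.card_biUnion_le
      obtain ⟨i, hi⟩ := hcover w hw
      exact Finset.mem_biUnion.2 ⟨i, Finset.mem_univ i, Finset.mem_filter.2 ⟨hw, hi⟩⟩
    obtain ⟨i, -, hi⟩ := Finset.exists_le_of_sum_le (s := Finset.univ)
      (f := fun _ : Fin s' => L'.card)
      (g := fun i => s * (L'.filter fun w => ∀ j, g i j w).card) ⟨i₀, Finset.mem_univ i₀⟩ (by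
        rw [← Finset.mul_sum, Finset.sum_const, Finset.card_univ, Fintype.card_fin, smul_eq_mul]
        exact Nat.mul_le_mul hs' hcard)
    exact ⟨i, hi⟩
  obtain ⟨u, hu, huL⟩ := hlim _ (Finset.filter_subset _ _) hi
  refine ⟨u, (hCg u).2 ⟨i, fun j => ?_⟩, huL⟩
  obtain ⟨P, hP, hloc⟩ := hg i j
  obtain ⟨v, hv, huv⟩ := hu P hP
  exact (hloc u v huv).2 ((Finset.mem_filter.1 (Finset.mem_coe.1 hv)).2 j)
end

section
/- Let A be an alphabet and L a language over A (a set of lists over A); for n : ℕ write L_n for the set of words w of length n over A with List.ofFn w ∈ L. Suppose that for all k, c, d : ℕ there exist n : ℕ and a finite subset L' of L_n such that every finite subset F of L' with (c·(n+1)^d)·|F| ≥ |L'| admits a k-limit for F that does not belong to L_n. Then L is not recognized by any Σ₂ circuit family. -/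
/-- A conjunction of `k`-local predicates that holds on `F` holds at every `k`-limit for `F`. -/
theorem KLimit.forall_of_kLocal {ι A J : Type*} {k : ℕ} {F : Set (ι → A)} {u : ι → A}
    (hu : KLimit k F u) {g : J → (ι → A) → Prop} (hg : ∀ j, KLocal k (g j))
    (hF : ∀ v ∈ F, ∀ j, g j v) (j : J) : g j u := by
  obtain ⟨P, hP, hloc⟩ := hg j
  obtain ⟨v, hv, huv⟩ := hu P hP
  exact (hloc u v huv).2 (hF v hv j)

/-- If at most `s` predicates cover a nonempty finite set, one of them holds on at least
a `1/s` fraction of it. -/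
theorem Finset.exists_card_le_mul_card_filter {α β : Type*} [Fintype β] {s : ℕ}
    (hs : Fintype.card β ≤ s) (S : Finset α) (hS : S.Nonempty) (p : β → α → Prop)
    [∀ b, DecidablePred (p b)] (hp : ∀ a ∈ S, ∃ b, p b a) :
    ∃ b, S.card ≤ s * (S.filter (p b)).card := by
  classical
  have hcover : S.card ≤ ∑ b, (S.filter (p b)).card := by
    refine (Finset.card_le_card fun a ha => ?_).trans Finset.card_biUnion_le
    simpa [ha] using hp a ha
  obtain ⟨a, ha⟩ := hS
  obtain ⟨b₀, -⟩ := hp a ha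
  obtain ⟨b, -, hb⟩ := Finset.exists_le_of_sum_le (s := Finset.univ) ⟨b₀, Finset.mem_univ b₀⟩
    (f := fun _ : β => S.card) (g := fun b => s * (S.filter (p b)).card) (by
      rw [Finset.sum_const, Finset.card_univ, smul_eq_mul, ← Finset.mul_sum]
      exact Nat.mul_le_mul hs hcover)
  exact ⟨b, hb⟩

/-- If for all `k, c, d` there are arbitrarily chosen lengths `n` and finite sets
`L'` of words of `L` of length `n` such that every `F ⊆ L'` of proportion at least
`1/(c·(n+1)^d)` admits a `k`-limit outside `L_n`, then `L` is not recognized by a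
Σ₂ circuit family. -/
theorem not_recSigma2_of_klimits {A : Type*} (L : Language A)
    (h : ∀ k c d : ℕ, ∃ (n : ℕ) (L' : Finset (Fin n → A)),
      (∀ w ∈ L', List.ofFn w ∈ L) ∧
      ∀ F : Finset (Fin n → A), F ⊆ L' → (c * (n + 1) ^ d) * F.card ≥ L'.card →
        ∃ u : Fin n → A, KLimit k (↑F) u ∧ List.ofFn u ∉ L) :
    ¬ RecSigma2 L := by
  classical
  rintro ⟨k, c, d, hrec⟩
  obtain ⟨n, L', hL', hlim⟩ := h k c d
  obtain ⟨C, ⟨s', hs', J, g, hg, hC⟩, hCL⟩ := hrec n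
  have hne : L'.Nonempty := by
    by_contra hemp
    obtain ⟨u, hu, -⟩ := hlim ∅ (Finset.empty_subset _)
      (by simp [Finset.not_nonempty_iff_eq_empty.1 hemp])
    obtain ⟨v, hv, -⟩ := hu ∅ (by simp)
    simp at hv
  obtain ⟨i, hi⟩ := Finset.exists_card_le_mul_card_filter (by simpa using hs') L' hne
    (fun i w => ∀ j, g i j w) fun w hw => (hC w).1 ((hCL w).2 (hL' w hw))
  obtain ⟨u, hu, huL⟩ := hlim _ (Finset.filter_subset _ _) hi
  refine huL ((hCL u).1 ((hC u).2 ⟨i, hu.forall_of_kLocal (hg i) fun v hv => ?_⟩))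
  exact (Finset.mem_filter.1 (Finset.mem_coe.1 hv)).2
end

section
/- If the language K over A₃ is recognized by a Σ₂ circuit family, then the language Good over Bool is recognized by a Σ₂ circuit family. -/
/-- Words of length `m·m` over `Bool` indexed by `Fin m × Fin m` in which every
block contains exactly one `true`. -/
def GoodM (m : ℕ) : Set (Fin m × Fin m → Bool) :=
  {w | ∀ i : Fin m, ∃! j : Fin m, w (i, j) = true}

/-- Words in which exactly one block contains no `true` and every other block
contains exactly one `true`. -/
def BadM (m : ℕ) : Set (Fin m × Fin m → Bool) :=
  {w | ∃ i₀ : Fin m, (∀ j : Fin m, w (i₀, j) = false) ∧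
    ∀ i : Fin m, i ≠ i₀ → ∃! j : Fin m, w (i, j) = true}

/-- The word (indexed by `Fin m × Fin m`) corresponding to a list of length `m·m`;
position `(i,j)` is the `j`-th letter of the `i`-th block. -/
def listToWord (m : ℕ) (w : List Bool) (h : w.length = m * m) :
    Fin m × Fin m → Bool :=
  fun p => w.get ⟨p.1 * m + p.2, by
    have h1 : (p.1 : ℕ) < m := p.1.isLt
    have h2 : (p.2 : ℕ) < m := p.2.isLt
    rw [h]; nlinarith⟩

/-- The language `Good` over `Bool`. -/
def GoodLang : Language Bool :=
  {w | ∃ (m : ℕ) (h : w.length = m * m), listToWord m w h ∈ GoodM m}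

/-- The language `Bad` over `Bool`. -/
def BadLang : Language Bool :=
  {w | ∃ (m : ℕ) (h : w.length = m * m), listToWord m w h ∈ BadM m}

/-- The three-letter alphabet, with letters `la = a`, `lb = b`, `lc = c` (the neutral letter). -/
abbrev A₃ : Type := Fin 3
def la : A₃ := 0
def lb : A₃ := 1
def lc : A₃ := 2

open RegularExpression in
/-- The regular expression `(a·c*·b + c)*`. -/
def Kexp : RegularExpression A₃ :=
  (char la * (char lc).star * char lb + char lc).star

/-- The language `K = (a·c*·b + c)*`. -/
def Klang : Language A₃ := Kexp.matches'

/-- Precomposing a Σ₂-circuit with a map each of whose output letters depends on at most one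
input letter preserves size and locality. -/
theorem Sigma2Circuit.comp_of_local {ι κ A B : Type*} {s k : ℕ} {C : (κ → B) → Prop}
    (hC : Sigma2Circuit s k C) (φ : (ι → A) → κ → B)
    (hφ : ∀ q, ∃ P : Finset ι, P.card ≤ 1 ∧
      ∀ w v : ι → A, (∀ p ∈ P, w p = v p) → φ w q = φ v q) :
    Sigma2Circuit s k (fun w => C (φ w)) := by
  classical
  obtain ⟨s', hs, J, g, hg, h⟩ := hC
  choose R hR hφR using hφ
  refine ⟨s', hs, J, fun i j w => g i j (φ w), fun i j => ?_, fun w => h (φ w)⟩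
  obtain ⟨P, hP, hloc⟩ := hg i j
  refine ⟨P.biUnion R, ?_, fun w v hwv => hloc _ _ fun q hq => hφR q w v fun p hp =>
    hwv p (Finset.mem_biUnion.2 ⟨q, hq, hp⟩)⟩
  calc (P.biUnion R).card ≤ P.card * 1 := Finset.card_biUnion_le_card_mul _ _ _ fun q _ => hR q
    _ ≤ k := by simpa using hP

theorem Sigma2Circuit.mono {ι A : Type*} {s t k : ℕ} {C : (ι → A) → Prop}
    (hC : Sigma2Circuit s k C) (hst : s ≤ t) : Sigma2Circuit t k C := by
  obtain ⟨s', hs, hC⟩ := hC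
  exact ⟨s', hs.trans hst, hC⟩

theorem Sigma2Circuit.false {ι A : Type*} (s k : ℕ) :
    Sigma2Circuit s k (fun _ : ι → A => False) :=
  ⟨0, Nat.zero_le s, fun _ => Unit, fun i => i.elim0, fun i => i.elim0, fun _ => by simp⟩

/-- Acceptance by the two-state automaton of `K`; the state is `true` when
an `a` is waiting for its matching `b`. -/
def KAccepts : Bool → List A₃ → Prop
  | s, [] => s = false
  | s, x :: l =>
    if x = la then s = false ∧ KAccepts true l
    else if x = lb then s = true ∧ KAccepts false l
    else KAccepts s l

@[simp] theorem kAccepts_nil (s : Bool) : KAccepts s [] ↔ s = false := Iff.rfl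

@[simp] theorem kAccepts_la (s : Bool) (l : List A₃) :
    KAccepts s (la :: l) ↔ s = false ∧ KAccepts true l := by
  simp [KAccepts]

@[simp] theorem kAccepts_lb (s : Bool) (l : List A₃) :
    KAccepts s (lb :: l) ↔ s = true ∧ KAccepts false l := by
  simp [KAccepts, la, lb]

@[simp] theorem kAccepts_lc (s : Bool) (l : List A₃) :
    KAccepts s (lc :: l) ↔ KAccepts s l := by
  simp [KAccepts, la, lb, lc]

theorem append_mem_kstar {α : Type*} {L : Language α} {x y : List α} (hx : x ∈ L)
    (hy : y ∈ KStar.kstar L) : x ++ y ∈ KStar.kstar L := by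
  rw [← Language.one_add_self_mul_kstar_eq_kstar L]
  exact Or.inr (Language.append_mem_mul hx hy)

theorem kAccepts_append_of_mem_kstar_lc {x : List A₃} (hx : x ∈ KStar.kstar ({[lc]} : Language A₃))
    (s : Bool) (l : List A₃) : KAccepts s (x ++ l) ↔ KAccepts s l := by
  obtain ⟨L, rfl, hL⟩ := Language.mem_kstar.1 hx
  induction L with
  | nil => simp
  | cons y L ih =>
    have hy : y = [lc] := hL y (by simp)
    have hL' : ∀ z ∈ L, z ∈ ({[lc]} : Language A₃) := fun z hz => hL z (by simp [hz])
    have hx' := Language.join_mem_kstar hL'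
    subst hy
    simpa using ih hL' hx'

theorem klang_eq : Klang = KStar.kstar (({[la]} : Language A₃) *
    KStar.kstar ({[lc]} : Language A₃) * {[lb]} + {[lc]}) := by
  simp [Klang, Kexp]

theorem kAccepts_of_mem_klang {x : List A₃} (hx : x ∈ Klang) : KAccepts false x := by
  rw [klang_eq] at hx
  obtain ⟨L, rfl, hL⟩ := Language.mem_kstar.1 hx
  clear hx
  induction L with
  | nil => simp
  | cons y L ih =>
    have ih := ih fun z hz => hL z (by simp [hz])
    rcases hL y (by simp) with hy | hy
    · obtain ⟨u, hu, v, hv, rfl⟩ := hy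
      obtain ⟨u', hu', t, ht, rfl⟩ := hu
      obtain rfl : u' = [la] := hu'
      obtain rfl : v = [lb] := hv
      simpa [kAccepts_append_of_mem_kstar_lc ht] using ih
    · obtain rfl : y = [lc] := hy
      simpa using ih

theorem mem_klang_of_kAccepts (x : List A₃) : (KAccepts false x → x ∈ Klang) ∧
    (KAccepts true x → ∃ u ∈ KStar.kstar ({[lc]} : Language A₃), ∃ v ∈ Klang,
      x = u ++ lb :: v) := by
  induction x with
  | nil => exact ⟨fun _ => by rw [klang_eq]; exact Language.nil_mem_kstar _, by simp⟩
  | cons y x ih =>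
    obtain rfl | rfl | rfl : y = la ∨ y = lb ∨ y = lc := by
      revert y; decide
    · refine ⟨fun h => ?_, by simp⟩
      obtain ⟨u, hu, v, hv, rfl⟩ := ih.2 ((kAccepts_la _ _).1 h).2
      rw [klang_eq] at hv ⊢
      have hb : [la] ++ u ++ [lb] ∈ ({[la]} : Language A₃) *
          KStar.kstar ({[lc]} : Language A₃) * {[lb]} :=
        Language.append_mem_mul (Language.append_mem_mul rfl hu) rfl
      simpa using append_mem_kstar (Or.inl hb) hv
    · refine ⟨by simp, fun h => ⟨[], Language.nil_mem_kstar _, x, ?_, rfl⟩⟩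
      exact ih.1 ((kAccepts_lb _ _).1 h).2
    · refine ⟨fun h => ?_, fun h => ?_⟩
      · have hx := ih.1 ((kAccepts_lc _ _).1 h)
        rw [klang_eq] at hx ⊢
        exact append_mem_kstar (x := [lc]) (Or.inr rfl) hx
      · obtain ⟨u, hu, v, hv, rfl⟩ := ih.2 ((kAccepts_lc _ _).1 h)
        exact ⟨lc :: u, append_mem_kstar (x := [lc]) rfl hu, v, hv, rfl⟩

theorem mem_klang_iff {x : List A₃} : x ∈ Klang ↔ KAccepts false x :=
  ⟨kAccepts_of_mem_klang, (mem_klang_of_kAccepts x).1⟩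

/-- The letter `true` is encoded as `a`, the letter `false` as the neutral letter `c`. -/
def boolToA₃ (x : Bool) : A₃ := if x then la else lc

theorem kAccepts_block (B : List Bool) (l : List A₃) (s : Bool) :
    KAccepts s (B.map boolToA₃ ++ lb :: l) ↔
      B.count true + s.toNat = 1 ∧ KAccepts false l := by
  induction B generalizing s with
  | nil => cases s <;> simp
  | cons x B ih => cases x <;> cases s <;> simp [boolToA₃, ih]

theorem kAccepts_flatten_blocks (L : List (List Bool)) :
    KAccepts false (L.map fun B => B.map boolToA₃ ++ [lb]).flatten ↔
      ∀ B ∈ L, B.count true = 1 := by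
  induction L with
  | nil => simp
  | cons B L ih => simp [kAccepts_block, ih]

theorem count_true_ofFn_eq_one {m : ℕ} (f : Fin m → Bool) :
    (List.ofFn f).count true = 1 ↔ ∃! j, f j = true := by
  induction m with
  | zero => simp
  | succ m ih =>
    rw [List.ofFn_succ]
    cases h : f 0
    · rw [List.count_cons_of_ne (by simp), ih]
      refine ⟨fun ⟨j, hj, hu⟩ => ⟨j.succ, hj, fun i hi => ?_⟩, fun ⟨j, hj, hu⟩ => ?_⟩
      · cases i using Fin.cases with
        | zero => simp [h] at hi
        | succ i => rw [hu i hi]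
      · cases j using Fin.cases with
        | zero => simp [h] at hj
        | succ j => exact ⟨j, hj, fun i hi => Fin.succ_injective _ (hu _ hi)⟩
    · have : (∀ j : Fin m, f j.succ ≠ true) ↔ ∃! j, f j = true := by
        refine ⟨fun hj => ⟨0, h, fun i hi => ?_⟩, fun hu j hj =>
          Fin.succ_ne_zero j (hu.unique hj h)⟩
        cases i using Fin.cases with
        | zero => rfl
        | succ i => exact absurd hi (hj i)
      rw [← this, List.count_cons_self, Nat.add_eq_right, List.count_eq_zero]
      simp [List.mem_ofFn]

theorem block_index_lt {m q : ℕ} (hq : q < m * (m + 1)) (h : q % (m + 1) < m) :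
    q / (m + 1) * m + q % (m + 1) < m * m := by
  have : q / (m + 1) < m := Nat.div_lt_of_lt_mul (by rwa [mul_comm] at hq)
  nlinarith

/-- Replace every letter of an `m × m` word by its encoding and append a `b` to every block. -/
def blockEncode (m : ℕ) (w : Fin (m * m) → Bool) (q : Fin (m * (m + 1))) : A₃ :=
  if h : (q : ℕ) % (m + 1) < m then
    boolToA₃ (w ⟨q / (m + 1) * m + q % (m + 1), block_index_lt q.isLt h⟩)
  else lb

theorem blockEncode_local (m : ℕ) (q : Fin (m * (m + 1))) :
    ∃ P : Finset (Fin (m * m)), P.card ≤ 1 ∧ ∀ w v : Fin (m * m) → Bool,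
      (∀ p ∈ P, w p = v p) → blockEncode m w q = blockEncode m v q := by
  by_cases h : (q : ℕ) % (m + 1) < m
  · refine ⟨{⟨_, block_index_lt q.isLt h⟩}, (Finset.card_singleton _).le, fun w v hwv => ?_⟩
    simp only [blockEncode, dif_pos h]
    rw [hwv _ (Finset.mem_singleton_self _)]
  · exact ⟨∅, by simp, fun w v _ => by simp [blockEncode, h]⟩

theorem ofFn_blockEncode (m : ℕ) (w : Fin (m * m) → Bool) :
    List.ofFn (blockEncode m w) = ((List.ofFn fun i : Fin m => List.ofFn fun j : Fin m =>
      listToWord m (List.ofFn w) List.length_ofFn (i, j)).map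
        fun B => B.map boolToA₃ ++ [lb]).flatten := by
  rw [List.ofFn_mul, List.map_ofFn]
  congr 2
  funext i
  have hdiv (j : ℕ) (hj : j < m + 1) : ((i : ℕ) * (m + 1) + j) / (m + 1) = i := by
    rw [mul_comm, Nat.mul_add_div (Nat.succ_pos m), Nat.div_eq_of_lt hj, add_zero]
  have hmod (j : ℕ) (hj : j < m + 1) : ((i : ℕ) * (m + 1) + j) % (m + 1) = j := by
    rw [Nat.mul_add_mod_self_right, Nat.mod_eq_of_lt hj]
  rw [List.ofFn_succ', List.concat_eq_append]
  simp only [Function.comp_apply, List.map_ofFn]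
  congr 1
  · congr 1
    funext j
    have hj : (j : ℕ) < m + 1 := j.isLt.trans (Nat.lt_succ_self m)
    simp [blockEncode, hmod _ hj, hdiv _ hj, listToWord]
  · simp [blockEncode, hmod m (Nat.lt_succ_self m)]

theorem ofFn_mem_goodLang_iff (m : ℕ) (w : Fin (m * m) → Bool) :
    List.ofFn w ∈ GoodLang ↔ listToWord m (List.ofFn w) List.length_ofFn ∈ GoodM m := by
  refine ⟨fun ⟨m', h, hw⟩ => ?_, fun h => ⟨m, List.length_ofFn, h⟩⟩
  obtain rfl : m = m' := Nat.mul_self_inj.1 (by simpa using h)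
  exact hw

theorem ofFn_blockEncode_mem_klang_iff (m : ℕ) (w : Fin (m * m) → Bool) :
    List.ofFn (blockEncode m w) ∈ Klang ↔ List.ofFn w ∈ GoodLang := by
  rw [ofFn_mem_goodLang_iff, mem_klang_iff, ofFn_blockEncode, kAccepts_flatten_blocks]
  simp [GoodM, List.mem_ofFn, count_true_ofFn_eq_one]

/-- If `K = (ac*b + c)*` is recognized by a Σ₂ circuit family, then so is `Good`. -/
theorem recSigma2_good_of_recSigma2_K (h : RecSigma2 Klang) : RecSigma2 GoodLang := by
  obtain ⟨k, c, d, h⟩ := h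
  refine ⟨k, c * 2 ^ d, d, fun n => ?_⟩
  by_cases hn : ∃ m, n = m * m
  · obtain ⟨m, rfl⟩ := hn
    obtain ⟨C, hC, hK⟩ := h (m * (m + 1))
    refine ⟨fun w => C (blockEncode m w),
      (hC.comp_of_local _ (blockEncode_local m)).mono ?_, fun w => ?_⟩
    · rw [mul_assoc, ← mul_pow]
      gcongr
      nlinarith [Nat.le_mul_self m]
    · exact (hK _).trans (ofFn_blockEncode_mem_klang_iff m w)
  · refine ⟨fun _ => False, Sigma2Circuit.false _ _, fun w => ?_⟩
    refine ⟨False.elim, fun ⟨m, hm, _⟩ => hn ⟨m, by simpa using hm⟩⟩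
end

section
/- For every k : ℕ there exists N : ℕ such that for all m ≥ N: every finite set F ⊆ Good_m with |F| > k^m admits a k-limit (a word of length m·m over Bool, indexed by Fin m × Fin m) that lies outside Good_m. Moreover, for every k and d there exists N such that for all m ≥ N, every finite F ⊆ Good_m with |F|·(m·m)^d ≥ m^m satisfies |F| > k^m, and hence admits a k-limit outside Good_m. -/
/-- The set of positions at which a Boolean word is `true`. -/
def trueSet {ι : Type*} [Fintype ι] (w : ι → Bool) : Finset ι :=
  Finset.univ.filter fun p => w p = true

theorem mem_trueSet {ι : Type*} [Fintype ι] {w : ι → Bool} {p : ι} :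
    p ∈ trueSet w ↔ w p = true := by
  simp [trueSet]

theorem trueSet_injective {ι : Type*} [Fintype ι] :
    Function.Injective (trueSet : (ι → Bool) → Finset ι) := by
  intro v w h
  funext p
  rw [Bool.eq_iff_iff, ← mem_trueSet, ← mem_trueSet, h]

theorem card_trueSet_of_mem_GoodM {m : ℕ} {w : Fin m × Fin m → Bool} (hw : w ∈ GoodM m) :
    (trueSet w).card = m := by
  choose f hf hu using hw
  have h : trueSet w = Finset.univ.image fun i => (i, f i) := by
    ext ⟨i, j⟩
    simp only [mem_trueSet, Finset.mem_image, Finset.mem_univ, true_and, Prod.mk.injEq]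
    constructor
    · intro h
      exact ⟨i, rfl, (hu i j h).symm⟩
    · rintro ⟨_, rfl, rfl⟩
      exact hf _
  rw [h, Finset.card_image_of_injective _ fun a b h => (Prod.ext_iff.1 h).1, Finset.card_univ,
    Fintype.card_fin]

/-- If every set `Y` of size less than `s` admits a set `P` of size at most `k` meeting `S \ Y` for
all `S ∈ F` containing `Y`, then at most `k ^ n` members of the `s`-uniform family `F` contain a
given set of size `s - n`. -/
theorem card_filter_superset_le {ι : Type*} [DecidableEq ι] {k s : ℕ} {F : Finset (Finset ι)}
    (hF : ∀ S ∈ F, S.card = s)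
    (hP : ∀ Y : Finset ι, Y.card < s →
      ∃ P : Finset ι, P.card ≤ k ∧ ∀ S ∈ F, Y ⊆ S → ∃ p ∈ P, p ∈ S ∧ p ∉ Y)
    (n : ℕ) (Y : Finset ι) (hY : Y.card + n = s) :
    (F.filter (Y ⊆ ·)).card ≤ k ^ n := by
  induction n generalizing Y with
  | zero =>
    have key : ∀ S ∈ F.filter (Y ⊆ ·), S = Y := fun S hS => by
      obtain ⟨hS, hYS⟩ := Finset.mem_filter.1 hS
      exact (Finset.eq_of_subset_of_card_le hYS (by rw [hF S hS]; omega)).symm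
    exact Finset.card_le_one.2 fun S hS T hT => (key S hS).trans (key T hT).symm
  | succ n ih =>
    obtain ⟨P, hPk, hPF⟩ := hP Y (by omega)
    have hsub : F.filter (Y ⊆ ·) ⊆
        (P \ Y).biUnion fun p => F.filter (insert p Y ⊆ ·) := by
      intro S hS
      obtain ⟨hS, hYS⟩ := Finset.mem_filter.1 hS
      obtain ⟨p, hp, hpS, hpY⟩ := hPF S hS hYS
      exact Finset.mem_biUnion.2 ⟨p, Finset.mem_sdiff.2 ⟨hp, hpY⟩,
        Finset.mem_filter.2 ⟨hS, Finset.insert_subset hpS hYS⟩⟩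
    calc (F.filter (Y ⊆ ·)).card
        ≤ _ := Finset.card_le_card hsub
      _ ≤ (P \ Y).card * k ^ n := Finset.card_biUnion_le_card_mul _ _ _ fun p hp => ih _ <| by
          rw [Finset.card_insert_of_notMem (Finset.mem_sdiff.1 hp).2]
          omega
      _ ≤ k * k ^ n :=
          Nat.mul_le_mul_right _ ((Finset.card_le_card Finset.sdiff_subset).trans hPk)
      _ = k ^ (n + 1) := (pow_succ' k n).symm

/-- A weak form of the sunflower lemma: a uniform family of more than `k ^ s` sets of size `s` has
a core `Y` with fewer than `s` elements such that no set of at most `k` points meets `S \ Y` for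
all members `S ⊇ Y`. -/
theorem exists_flower {ι : Type*} [DecidableEq ι] {k s : ℕ} {F : Finset (Finset ι)}
    (hF : ∀ S ∈ F, S.card = s) (hcard : k ^ s < F.card) :
    ∃ Y : Finset ι, Y.card < s ∧
      ∀ P : Finset ι, P.card ≤ k → ∃ S ∈ F, Y ⊆ S ∧ ∀ p ∈ P, p ∈ S → p ∈ Y := by
  by_contra! hP
  have h := card_filter_superset_le hF hP s ∅ (by simp)
  simp only [Finset.empty_subset, Finset.filter_true] at h
  omega

theorem exists_kLimit_notMem_GoodM {k m : ℕ} {F : Finset (Fin m × Fin m → Bool)}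
    (hF : ↑F ⊆ GoodM m) (hcard : k ^ m < F.card) :
    ∃ u : Fin m × Fin m → Bool, KLimit k (↑F) u ∧ u ∉ GoodM m := by
  obtain ⟨Y, hYm, hY⟩ := exists_flower (k := k) (s := m) (F := F.image trueSet)
    (Finset.forall_mem_image.2 fun w hw => card_trueSet_of_mem_GoodM (hF hw))
    (by rwa [Finset.card_image_of_injective _ trueSet_injective])
  refine ⟨fun p => decide (p ∈ Y), fun P hP => ?_, fun hu => ?_⟩
  · obtain ⟨S, hS, hYS, hPS⟩ := hY P hP
    obtain ⟨v, hv, rfl⟩ := Finset.mem_image.1 hS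
    refine ⟨v, hv, fun p hp => ?_⟩
    rw [Bool.eq_iff_iff, decide_eq_true_iff, ← mem_trueSet]
    exact ⟨fun h => hYS h, hPS p hp⟩
  · have h := card_trueSet_of_mem_GoodM hu
    have hu_eq : trueSet (fun p => decide (p ∈ Y)) = Y := by
      ext p
      simp [mem_trueSet]
    rw [hu_eq] at h
    omega

theorem pow_mul_sq_pow_lt_pow_self {k d m : ℕ} (hm : k ^ 2 + 1 + 4 * d ≤ m) :
    k ^ m * (m * m) ^ d < m ^ m := by
  have hm0 : 0 < m := by omega
  refine lt_of_pow_lt_pow_left₀ 2 (Nat.zero_le _) ?_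
  calc (k ^ m * (m * m) ^ d) ^ 2 = (k ^ 2) ^ m * m ^ (4 * d) := by ring
    _ < m ^ m * m ^ (4 * d) :=
        Nat.mul_lt_mul_of_pos_right (Nat.pow_lt_pow_left (by omega) hm0.ne') (by positivity)
    _ = m ^ (m + 4 * d) := (pow_add _ _ _).symm
    _ ≤ m ^ (m * 2) := Nat.pow_le_pow_right hm0 (by omega)
    _ = (m ^ m) ^ 2 := pow_mul _ _ _

/-- Large subsets of `Good_m` have a `k`-limit outside `Good_m`; in particular
subsets of density at least `1/(m·m)^d` do. -/
theorem good_klimit :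
    (∀ k : ℕ, ∃ N : ℕ, ∀ m : ℕ, N ≤ m → ∀ F : Finset (Fin m × Fin m → Bool),
      ↑F ⊆ GoodM m → k ^ m < F.card →
        ∃ u : Fin m × Fin m → Bool, KLimit k (↑F) u ∧ u ∉ GoodM m) ∧
    (∀ k d : ℕ, ∃ N : ℕ, ∀ m : ℕ, N ≤ m → ∀ F : Finset (Fin m × Fin m → Bool),
      ↑F ⊆ GoodM m → m ^ m ≤ F.card * (m * m) ^ d →
        k ^ m < F.card ∧
          ∃ u : Fin m × Fin m → Bool, KLimit k (↑F) u ∧ u ∉ GoodM m) := by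
  refine ⟨fun k => ⟨0, fun m _ F hF hcard => exists_kLimit_notMem_GoodM hF hcard⟩,
    fun k d => ⟨k ^ 2 + 1 + 4 * d, fun m hm F hF hcard => ?_⟩⟩
  have hlt : k ^ m < F.card :=
    lt_of_mul_lt_mul_right ((pow_mul_sq_pow_lt_pow_self hm).trans_le hcard) (Nat.zero_le _)
  exact ⟨hlt, exists_kLimit_notMem_GoodM hF hlt⟩
end

section
/- Let M be a finite ordered monoid, and let x, y ∈ M be such that x·x = x, y is a subword of x, and ¬(x ≤ x·y·x). If the up-word problem T = {w : List M | x ≤ w.prod} (a language over the alphabet M) is recognized by a Σ₂ circuit family, then there exist k, c, d : ℕ such that for every m : ℕ there is a (c·(m·m+1)^d, k)-Σ₂-circuit on words of length m·m over Bool that accepts every word of Good_m and rejects every word of Bad_m. -/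
/-- The position in `Fin (m*m)` of the pair `(i,j)`, namely `i·m + j`. -/
def pairIdx {m : ℕ} (p : Fin m × Fin m) : Fin (m * m) :=
  ⟨p.1 * m + p.2, by
    have h1 : (p.1 : ℕ) < m := p.1.isLt
    have h2 : (p.2 : ℕ) < m := p.2.isLt
    nlinarith⟩

/-- `y` is a subword of `x` in the monoid `M`. -/
def IsSubwordOf {M : Type*} [Monoid M] (y x : M) : Prop :=
  ∃ u v : List M, v.Sublist u ∧ u.prod = x ∧ v.prod = y

/-- A gate `(a, none)` outputs the constant letter `a`, and a gate `(a, some p)` outputs `a`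
when the input bit at position `p` is `true` and `1` otherwise. -/
def gateEval {ι M : Type*} [One M] (v : ι → Bool) : M × Option ι → M
  | (a, none) => a
  | (a, some p) => if v p then a else 1

theorem KLocal.comp_gates {ι M : Type*} [One M] {N k : ℕ} {g : (Fin N → M) → Prop}
    (hg : KLocal k g) (F : Fin N → M × Option ι) :
    KLocal k (fun v : ι → Bool => g (fun t => gateEval v (F t))) := by
  classical
  obtain ⟨P, hP, h⟩ := hg
  refine ⟨P.biUnion fun t => (F t).2.toFinset, ?_, fun w v hwv => h _ _ fun t ht => ?_⟩
  · refine (Finset.card_biUnion_le_card_mul _ _ 1 fun t _ => ?_).trans (by simpa using hP)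
    cases (F t).2 <;> simp
  · rcases hF : F t with ⟨a, _ | p⟩
    · rfl
    · have hp : w p = v p := hwv p (Finset.mem_biUnion.2 ⟨t, ht, by simp [hF]⟩)
      simp [gateEval, hp]

theorem Sigma2Circuit.comp_gates {ι M : Type*} [One M] {N s k : ℕ} {C : (Fin N → M) → Prop}
    (hC : Sigma2Circuit s k C) (F : Fin N → M × Option ι) :
    Sigma2Circuit s k (fun v : ι → Bool => C (fun t => gateEval v (F t))) := by
  obtain ⟨s', hs, J, g, hg, h⟩ := hC
  exact ⟨s', hs, J, fun i j v => g i j (fun t => gateEval v (F t)),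
    fun i j => (hg i j).comp_gates F, fun v => h _⟩

/-- A sublist, recorded by marking the letters of the larger list that are kept. -/
theorem List.Sublist.exists_marking {α : Type*} {v u : List α} (h : v.Sublist u) :
    ∃ L : List (α × Bool), L.map Prod.fst = u ∧ (L.filter Prod.snd).map Prod.fst = v := by
  induction h with
  | slnil => exact ⟨[], rfl, rfl⟩
  | cons a _ ih =>
    obtain ⟨L, rfl, rfl⟩ := ih
    exact ⟨(a, false) :: L, by simp, by simp⟩
  | cons_cons a _ ih =>
    obtain ⟨L, rfl, rfl⟩ := ih
    exact ⟨(a, true) :: L, by simp, by simp⟩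

/-- Gates of one block: a kept letter becomes a constant gate, and any other letter becomes a
gate for each position of the block. -/
def blockGates {ι M : Type*} (Q : List ι) (L : List (M × Bool)) : List (M × Option ι) :=
  L.flatMap fun a => if a.2 then [(a.1, none)] else Q.map fun q => (a.1, some q)

theorem length_blockGates_le {ι M : Type*} (Q : List ι) (L : List (M × Bool)) :
    (blockGates Q L).length ≤ L.length * (Q.length + 1) := by
  induction L with
  | nil => simp [blockGates]
  | cons a L ih =>
    rcases a with ⟨a, _ | _⟩ <;> simp [blockGates] at ih ⊢ <;> nlinarith

theorem prod_blockGates_of_forall_false {ι M : Type*} [Monoid M] (Q : List ι)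
    (L : List (M × Bool)) (v : ι → Bool) (hv : ∀ q ∈ Q, v q = false) :
    ((blockGates Q L).map (gateEval v)).prod = ((L.filter Prod.snd).map Prod.fst).prod := by
  induction L with
  | nil => simp [blockGates]
  | cons a L ih =>
    have hQ (a : M) : ((Q.map fun q => (a, some q)).map (gateEval v)).prod = 1 := by
      refine List.prod_eq_one fun z hz => ?_
      simp only [List.map_map, List.mem_map] at hz
      obtain ⟨q, hq, rfl⟩ := hz
      simp [gateEval, hv q hq]
    rcases a with ⟨a, _ | _⟩
    · simpa [blockGates, hQ] using (congrArg₂ (· * ·) (hQ a) ih)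
    · simpa [blockGates, gateEval] using congrArg (a * ·) ih

theorem prod_blockGates_of_unique {ι M : Type*} [Monoid M] {Q : List ι} (hQ : Q.Nodup)
    (L : List (M × Bool)) (v : ι → Bool) {p : ι} (hp : p ∈ Q) (hvp : v p = true)
    (hv : ∀ q ∈ Q, v q = true → q = p) :
    ((blockGates Q L).map (gateEval v)).prod = (L.map Prod.fst).prod := by
  classical
  induction L with
  | nil => simp [blockGates]
  | cons a L ih =>
    have hQ (a : M) : ((Q.map fun q => (a, some q)).map (gateEval v)).prod = a := by
      rw [List.map_map, List.prod_map_eq_pow_single p, List.count_eq_one_of_mem hQ hp]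
      · simp [gateEval, hvp]
      · intro q hqp hq
        have : v q ≠ true := fun h => hqp (hv q hq h)
        simp [gateEval, this]
    rcases a with ⟨a, _ | _⟩
    · simpa [blockGates] using (congrArg₂ (· * ·) (hQ a) ih)
    · simpa [blockGates, gateEval] using congrArg (a * ·) ih

theorem mul_prod_map_of_idempotent {ι M : Type*} [Monoid M] {x : M} (hx : x * x = x)
    {f : ι → M} {l : List ι} (h : ∀ i ∈ l, f i = x) : x * (l.map f).prod = x := by
  induction l with
  | nil => simp
  | cons i l ih =>
    rw [List.map_cons, List.prod_cons, h i (by simp), ← mul_assoc, hx]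
    exact ih fun j hj => h j (by simp [hj])

theorem prod_map_mul_of_idempotent {ι M : Type*} [Monoid M] {x : M} (hx : x * x = x)
    {f : ι → M} {l : List ι} (h : ∀ i ∈ l, f i = x) : (l.map f).prod * x = x := by
  induction l with
  | nil => simp
  | cons i l ih =>
    rw [List.map_cons, List.prod_cons, h i (by simp), mul_assoc,
      ih fun j hj => h j (by simp [hj]), hx]

theorem mul_prod_map_mul_of_idempotent {ι M : Type*} [Monoid M] {x y : M} (hx : x * x = x)
    {f : ι → M} {l : List ι} (hl : l.Nodup) {i₀ : ι} (hi : i₀ ∈ l) (hy : f i₀ = y)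
    (h : ∀ i ∈ l, i ≠ i₀ → f i = x) : x * (l.map f).prod * x = x * y * x := by
  obtain ⟨s, t, rfl⟩ := List.append_of_mem hi
  rw [List.nodup_middle, List.nodup_cons] at hl
  have hs : ∀ i ∈ s, f i = x := fun i his =>
    h i (by simp [his]) (by rintro rfl; exact hl.1 (by simp [his]))
  have ht : ∀ i ∈ t, f i = x := fun i hit =>
    h i (by simp [hit]) (by rintro rfl; exact hl.1 (by simp [hit]))
  rw [List.map_append, List.map_cons, List.prod_append, List.prod_cons, hy, ← mul_assoc,
    mul_prod_map_of_idempotent hx hs, mul_assoc, mul_assoc, prod_map_mul_of_idempotent hx ht,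
    mul_assoc]

theorem pairIdx_right_injective {m : ℕ} (i : Fin m) :
    Function.Injective fun j : Fin m => pairIdx (i, j) := by
  intro j k h
  simpa [pairIdx, Fin.ext_iff] using h

/-- The positions of the `i`-th block of a word of length `m * m`. -/
def blockPositions {m : ℕ} (i : Fin m) : List (Fin (m * m)) :=
  (List.finRange m).map fun j => pairIdx (i, j)

/-- The gates of all blocks, surrounded by two constant gates `x`. -/
def wordGates {M : Type*} (m : ℕ) (x : M) (L : List (M × Bool)) :
    List (M × Option (Fin (m * m))) :=
  (x, none) :: ((List.finRange m).flatMap fun i => blockGates (blockPositions i) L) ++ [(x, none)]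

theorem length_wordGates_le {M : Type*} (m : ℕ) (x : M) (L : List (M × Bool)) :
    (wordGates m x L).length + 1 ≤ (2 * L.length + 3) * (m * m + 1) := by
  have hsum : ((List.finRange m).map fun i =>
      (blockGates (blockPositions i) L).length).sum ≤ m * (L.length * (m + 1)) := by
    have := List.sum_le_card_nsmul
      ((List.finRange m).map fun i => (blockGates (blockPositions i) L).length)
      (L.length * (m + 1)) (by
        intro n hn
        obtain ⟨i, -, rfl⟩ := List.mem_map.1 hn
        simpa [blockPositions] using length_blockGates_le (blockPositions i) L)
    simpa using this
  have hm : m ≤ m * m := Nat.le_mul_self m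
  have : (wordGates m x L).length = ((List.finRange m).map fun i =>
      (blockGates (blockPositions i) L).length).sum + 2 := by
    simp [wordGates, List.length_flatMap]
  rw [this]
  nlinarith [Nat.mul_le_mul_left L.length hm]

theorem prod_wordGates {M : Type*} [Monoid M] {m : ℕ} (x : M) (L : List (M × Bool))
    (v : Fin (m * m) → Bool) :
    ((wordGates m x L).map (gateEval v)).prod = x * ((List.finRange m).map fun i =>
      ((blockGates (blockPositions i) L).map (gateEval v)).prod).prod * x := by
  have (l : List (Fin m)) :
      ((l.flatMap fun i => blockGates (blockPositions i) L).map (gateEval v)).prod =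
        (l.map fun i => ((blockGates (blockPositions i) L).map (gateEval v)).prod).prod := by
    induction l with
    | nil => rfl
    | cons i l ih => simp only [List.flatMap_cons, List.map_append, List.prod_append, ih,
        List.map_cons, List.prod_cons]
  rw [← this]
  simp [wordGates, gateEval, mul_assoc]

theorem prod_blockGates_of_existsUnique {M : Type*} [Monoid M] {m : ℕ} (L : List (M × Bool))
    (v : Fin (m * m) → Bool) (i : Fin m) (h : ∃! j : Fin m, v (pairIdx (i, j)) = true) :
    ((blockGates (blockPositions i) L).map (gateEval v)).prod = (L.map Prod.fst).prod := by
  obtain ⟨j, hj, huniq⟩ := h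
  refine prod_blockGates_of_unique ((List.nodup_finRange m).map (pairIdx_right_injective i)) L v
    (List.mem_map_of_mem (List.mem_finRange j)) hj fun q hq hvq => ?_
  obtain ⟨k, -, rfl⟩ := List.mem_map.1 hq
  rw [huniq k hvq]

/-- If the up-word problem `T = {w | x ≤ w.prod}` of a finite ordered monoid `M`
(for an idempotent `x` with a subword `y` such that `¬ x ≤ x·y·x`) is recognized
by a Σ₂ circuit family, then there are polynomial-size Σ₂ circuits of constant
top fan-in on words of length `m·m` over `Bool` separating `Good_m` from `Bad_m`. -/
theorem sigma2_sep_good_bad_of_upword {M : Type*} [Monoid M] [Fintype M]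
    [PartialOrder M] [CovariantClass M M (· * ·) (· ≤ ·)]
    [CovariantClass M M (Function.swap (· * ·)) (· ≤ ·)]
    (x y : M) (hx : x * x = x) (hsub : IsSubwordOf y x) (hneq : ¬ x ≤ x * y * x)
    (hT : RecSigma2 ({w : List M | x ≤ w.prod} : Language M)) :
    ∃ k c d : ℕ, ∀ m : ℕ, ∃ C : (Fin (m * m) → Bool) → Prop,
      Sigma2Circuit (c * (m * m + 1) ^ d) k C ∧
      ∀ v : Fin (m * m) → Bool,
        ((fun p : Fin m × Fin m => v (pairIdx p)) ∈ GoodM m → C v) ∧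
        ((fun p : Fin m × Fin m => v (pairIdx p)) ∈ BadM m → ¬ C v) := by
  obtain ⟨k, c, d, hT⟩ := hT
  obtain ⟨u, u', hsubl, rfl, rfl⟩ := hsub
  obtain ⟨L, rfl, rfl⟩ := hsubl.exists_marking
  set x := (L.map Prod.fst).prod
  refine ⟨k, c * (2 * L.length + 3) ^ d, d, fun m => ?_⟩
  set W := wordGates m x L with hW
  obtain ⟨C, hC, hCT⟩ := hT W.length
  have hC' (v : Fin (m * m) → Bool) :
      C (fun t => gateEval v (W.get t)) ↔ x ≤ (W.map (gateEval v)).prod := by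
    have h : List.ofFn (fun t => gateEval v (W.get t)) = W.map (gateEval v) := by
      rw [← Function.comp_def, ← List.map_ofFn, List.ofFn_get]
    rw [hCT, h]
    rfl
  refine ⟨_, (hC.comp_gates W.get).mono ?_, fun v => ⟨fun hgood => ?_, fun hbad => ?_⟩⟩
  · rw [mul_assoc, ← mul_pow]
    exact Nat.mul_le_mul_left c (Nat.pow_le_pow_left (length_wordGates_le m x L) d)
  · rw [hC', hW, prod_wordGates, mul_prod_map_of_idempotent hx, hx]
    exact fun i _ => prod_blockGates_of_existsUnique L v i (hgood i)
  · obtain ⟨i₀, hfalse, huniq⟩ := hbad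
    rw [hC', hW, prod_wordGates, mul_prod_map_mul_of_idempotent hx (List.nodup_finRange m)
      (List.mem_finRange i₀) (prod_blockGates_of_forall_false _ L v ?_)
      fun i _ hi => prod_blockGates_of_existsUnique L v i (huniq i hi)]
    · exact hneq
    · intro q hq
      obtain ⟨j, -, rfl⟩ := List.mem_map.1 hq
      exact hfalse j
end

section
/- For every k ≥ 1 there exists N : ℕ such that for all m ≥ N: every finite set F ⊆ Good_m that is k-tangled satisfies (|F| : ℝ) < (m : ℝ) ^ ((2·k·m : ℝ) / (2·k + 1)). Moreover, for every k ≥ 1 and every d : ℕ there exists N such that for all m ≥ N, every finite k-tangled F ⊆ Good_m satisfies |F|·(m·m)^d < m^m. -/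
/-- The unpacking of a packed word `ν : Fin m → Fin m`: `true` at `(i,j)` iff `j = ν i`. -/
def unpack {m : ℕ} (ν : Fin m → Fin m) : Fin m × Fin m → Bool :=
  fun p => decide (p.2 = ν p.1)

/-- The unpacking of a packed word over `Fin m` with an extra `⊥` letter (`none`). -/
def unpackOpt {m : ℕ} (μ : Fin m → Option (Fin m)) : Fin m × Fin m → Bool :=
  fun p => decide (μ p.1 = some p.2)

/-- A packed word agrees with a set of position/contents pairs. -/
def Agrees {m : ℕ} (lam : Fin m → Fin m) (S : Finset (Fin m × Fin m)) : Prop :=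
  ∀ p ∈ S, lam p.1 = p.2

/-- A set of pairs all of whose first components equal `i`. -/
def IsISet {m : ℕ} (i : Fin m) (D : Finset (Fin m × Fin m)) : Prop :=
  ∀ p ∈ D, p.1 = i

/-- `S` entails the `i`-set `D` (w.r.t. the set of packed words `Φ`). -/
def Entails {m : ℕ} (Φ : Set (Fin m → Fin m)) (S : Finset (Fin m × Fin m))
    (i : Fin m) (D : Finset (Fin m × Fin m)) : Prop :=
  (∀ p ∈ S, p.1 ≠ i) ∧
    ∀ lam ∈ Φ, Agrees lam S → ∃ c : Fin m, (i, c) ∈ D ∧ lam i = c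

/-- A set `Φ` of packed words is `k`-tangled. -/
def Tangled {m : ℕ} (k : ℕ) (Φ : Set (Fin m → Fin m)) : Prop :=
  ∀ μ ∈ Φ, ∀ i : Fin m, ∃ D : Finset (Fin m × Fin m),
    D.card ≤ k ∧ IsISet i D ∧ (i, μ i) ∈ D ∧
      ∃ S : Finset (Fin m × Fin m), S.card ≤ k ∧ Agrees μ S ∧ Entails Φ S i D

/-- A set `F ⊆ Good_m` is `k`-tangled if the set of packings of its elements is. -/
def FTangled {m : ℕ} (k : ℕ) (F : Set (Fin m × Fin m → Bool)) : Prop :=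
  Tangled k {ν : Fin m → Fin m | unpack ν ∈ F}

/-- The relation with out-neighbourhoods `N` is acyclic on `I`: every nonempty subset of `I`
has an element none of whose out-neighbours lies in that subset. -/
def IsAcyclicOn {ι : Type*} (N : ι → Finset ι) (I : Finset ι) : Prop :=
  ∀ J ⊆ I, J.Nonempty → ∃ i ∈ J, Disjoint (N i) J

theorem IsAcyclicOn.mono {ι : Type*} {N : ι → Finset ι} {I J : Finset ι}
    (h : IsAcyclicOn N I) (hJ : J ⊆ I) : IsAcyclicOn N J :=
  fun K hK => h K (hK.trans hJ)

/-- A loopless digraph with out-degrees at most `k` is acyclic on some set containing a proportion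
of at least `1 / (k + 1)` of the vertices. -/
theorem exists_isAcyclicOn {ι : Type*} [DecidableEq ι] {N : ι → Finset ι} {k : ℕ}
    (hloop : ∀ i, i ∉ N i) (hcard : ∀ i, (N i).card ≤ k) (V : Finset ι) :
    ∃ I ⊆ V, V.card ≤ (k + 1) * I.card ∧ IsAcyclicOn N I := by
  induction V using Finset.strongInduction with
  | H V ih =>
    obtain rfl | ⟨v, hv⟩ := V.eq_empty_or_nonempty
    · exact ⟨∅, subset_rfl, by simp, fun J hJ hne => by simp_all [Finset.subset_empty]⟩
    · obtain ⟨I, hIV, hVI, hI⟩ := ih (V \ insert v (N v))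
        (Finset.ssubset_iff_subset_ne.2 ⟨Finset.sdiff_subset, fun h => by
          simpa using h.symm.subset hv⟩)
      have hvI : v ∉ I := fun h => by simpa using hIV h
      refine ⟨insert v I, Finset.insert_subset hv (hIV.trans Finset.sdiff_subset), ?_, ?_⟩
      · have h₁ := Finset.le_card_sdiff (insert v (N v)) V
        have h₂ := Finset.card_insert_le v (N v)
        have h₃ := hcard v
        rw [Finset.card_insert_of_notMem hvI, mul_add]
        omega
      · intro J hJ hne
        by_cases hvJ : v ∈ J
        · refine ⟨v, hvJ, Finset.disjoint_left.2 fun j hj hjJ => ?_⟩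
          rcases Finset.mem_insert.1 (hJ hjJ) with rfl | hjI
          · exact hloop _ hj
          · have := hIV hjI
            simp_all
        · exact hI J (fun j hj => (Finset.mem_insert.1 (hJ hj)).resolve_left
            fun h => hvJ (h ▸ hj)) hne

section Counting

variable {ι β : Type*} [DecidableEq ι] [DecidableEq β] {Φ : Finset (ι → β)}
  {N : (ι → β) → ι → Finset ι} {k : ℕ}

/-- If the value at `i` of each `μ ∈ Φ` is determined up to `k` possibilities by its values on
`N μ i`, then at most `k ^ |I|` elements of `Φ` whose dependencies are acyclic on `I` share their
values outside `I`. -/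
theorem card_le_pow_of_isAcyclicOn
    (hΦ : ∀ μ ∈ Φ, ∀ i, ∃ D : Finset β, D.card ≤ k ∧
      ∀ ν ∈ Φ, (∀ j ∈ N μ i, ν j = μ j) → ν i ∈ D)
    (I : Finset ι) (Ψ : Finset (ι → β)) (hΨ : Ψ ⊆ Φ)
    (hac : ∀ μ ∈ Ψ, IsAcyclicOn (N μ) I)
    (hext : ∀ μ ∈ Ψ, ∀ ν ∈ Ψ, ∀ j ∉ I, ν j = μ j) :
    Ψ.card ≤ k ^ I.card := by
  induction I using Finset.strongInduction generalizing Ψ with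
  | H I ih =>
    obtain rfl | hI := I.eq_empty_or_nonempty
    · simpa using Finset.card_le_one.2 fun μ hμ ν hν => funext fun j => hext ν hν μ hμ j (by simp)
    obtain rfl | ⟨μ, hμ⟩ := Ψ.eq_empty_or_nonempty
    · simp
    obtain ⟨i, hi, hdisj⟩ := hac μ hμ I subset_rfl hI
    obtain ⟨D, hD, hmem⟩ := hΦ μ (hΨ hμ) i
    have hmaps : ∀ ν ∈ Ψ, ν i ∈ D := fun ν hν => hmem ν (hΨ hν) fun j hj =>
      hext μ hμ ν hν j (Finset.disjoint_left.1 hdisj hj)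
    have hfib : ∀ c ∈ D, (Ψ.filter fun ν => ν i = c).card ≤ k ^ (I.erase i).card := by
      intro c _
      refine ih _ (Finset.erase_ssubset hi) _ ((Finset.filter_subset _ _).trans hΨ)
        (fun ν hν => (hac ν (Finset.mem_filter.1 hν).1).mono (Finset.erase_subset _ _)) ?_
      intro ν hν ξ hξ j hj
      rw [Finset.mem_filter] at hν hξ
      by_cases hji : j = i
      · rw [hji, hν.2, hξ.2]
      · exact hext ν hν.1 ξ hξ.1 j fun h => hj (Finset.mem_erase.2 ⟨hji, h⟩)
    calc Ψ.card ≤ k ^ (I.erase i).card * D.card :=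
          Finset.card_le_mul_card_image_of_maps_to hmaps _ hfib
      _ ≤ k ^ (I.erase i).card * k := by gcongr
      _ = k ^ I.card := by rw [← pow_succ, Finset.card_erase_add_one hi]

theorem card_filter_isAcyclicOn_le [Fintype ι] [Fintype β]
    (hΦ : ∀ μ ∈ Φ, ∀ i, ∃ D : Finset β, D.card ≤ k ∧
      ∀ ν ∈ Φ, (∀ j ∈ N μ i, ν j = μ j) → ν i ∈ D)
    (I : Finset ι) [DecidablePred fun μ => IsAcyclicOn (N μ) I] :
    (Φ.filter fun μ => IsAcyclicOn (N μ) I).card ≤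
      k ^ I.card * Fintype.card β ^ (Fintype.card ι - I.card) := by
  have hcard : (Finset.univ : Finset ({j // j ∉ I} → β)).card =
      Fintype.card β ^ (Fintype.card ι - I.card) := by
    rw [Finset.card_univ, Fintype.card_fun, Fintype.card_subtype_compl, Fintype.card_coe]
  rw [← hcard]
  refine Finset.card_le_mul_card_image_of_maps_to (f := fun μ (j : {j // j ∉ I}) => μ j)
    (fun _ _ => Finset.mem_univ _) _ fun ρ _ => ?_
  refine card_le_pow_of_isAcyclicOn hΦ I _
    ((Finset.filter_subset _ _).trans (Finset.filter_subset _ _)) ?_ ?_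
  · intro μ hμ
    exact (Finset.mem_filter.1 (Finset.mem_filter.1 hμ).1).2
  · intro μ hμ ν hν j hj
    have h₁ := congrFun (Finset.mem_filter.1 hμ).2 ⟨j, hj⟩
    have h₂ := congrFun (Finset.mem_filter.1 hν).2 ⟨j, hj⟩
    exact h₂.trans h₁.symm

end Counting

/-- A `k`-tangled set of packed words is covered by `2 ^ m` classes, one for each set `I` on which
dependencies are acyclic. -/
theorem Tangled.card_le_sum {m k : ℕ} {Φ : Finset (Fin m → Fin m)}
    (h : Tangled k (Φ : Set (Fin m → Fin m))) :
    Φ.card ≤ ∑ I : Finset (Fin m) with m ≤ (k + 1) * I.card, k ^ I.card * m ^ (m - I.card) := by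
  classical
  have hS : ∀ μ i, ∃ S : Finset (Fin m), i ∉ S ∧ S.card ≤ k ∧ (μ ∈ Φ →
      ∃ D : Finset (Fin m), D.card ≤ k ∧ ∀ ν ∈ Φ, (∀ j ∈ S, ν j = μ j) → ν i ∈ D) := by
    intro μ i
    by_cases hμ : μ ∈ Φ
    · obtain ⟨D, hD, -, -, S, hS, hμS, hSi, hent⟩ := h μ hμ i
      refine ⟨S.image Prod.fst, ?_, Finset.card_image_le.trans hS, fun _ =>
        ⟨D.image Prod.snd, Finset.card_image_le.trans hD, fun ν hν hνS => ?_⟩⟩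
      · rw [Finset.mem_image]
        rintro ⟨p, hp, hpi⟩
        exact hSi p hp hpi
      · obtain ⟨c, hc, rfl⟩ := hent ν hν fun p hp =>
          (hνS _ (Finset.mem_image_of_mem _ hp)).trans (hμS p hp)
        exact Finset.mem_image_of_mem Prod.snd hc
    · exact ⟨∅, by simp, by simp, fun h => absurd h hμ⟩
  choose N hloop hcard hΦ using hS
  have hcover : Φ ⊆ (Finset.univ.filter fun I : Finset (Fin m) => m ≤ (k + 1) * I.card).biUnion
      fun I => Φ.filter fun μ => IsAcyclicOn (N μ) I := by
    intro μ hμ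
    obtain ⟨I, -, hcI, hI⟩ := exists_isAcyclicOn (hloop μ) (hcard μ) Finset.univ
    simp only [Finset.mem_biUnion, Finset.mem_filter, Finset.mem_univ, true_and]
    exact ⟨I, by simpa using hcI, hμ, hI⟩
  refine (Finset.card_le_card hcover).trans (Finset.card_biUnion_le.trans
    (Finset.sum_le_sum fun I _ => ?_))
  simpa using card_filter_isAcyclicOn_le (fun μ hμ i => hΦ μ i hμ) I

theorem Tangled.card_le_rpow {m k : ℕ} (hk : 1 ≤ k) (hm : 1 ≤ m) {Φ : Finset (Fin m → Fin m)}
    (h : Tangled k (Φ : Set (Fin m → Fin m))) :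
    (Φ.card : ℝ) ≤ (2 * k : ℝ) ^ m * (m : ℝ) ^ ((k * m : ℝ) / (k + 1)) := by
  have hterm : ∀ I ∈ (Finset.univ.filter fun I : Finset (Fin m) => m ≤ (k + 1) * I.card),
      (k : ℝ) ^ I.card * (m : ℝ) ^ (m - I.card) ≤
        (k : ℝ) ^ m * (m : ℝ) ^ ((k * m : ℝ) / (k + 1)) := by
    intro I hI
    have hIm : I.card ≤ m := by simpa using I.card_le_univ
    have hI' : (m : ℝ) ≤ (k + 1) * I.card := by exact_mod_cast (Finset.mem_filter.1 hI).2
    have hexp : ((m - I.card : ℕ) : ℝ) ≤ (k * m : ℝ) / (k + 1) := by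
      rw [Nat.cast_sub hIm, le_div_iff₀ (by positivity)]
      linarith
    rw [← Real.rpow_natCast (m : ℝ) (m - I.card)]
    gcongr
    · exact_mod_cast hk
    · exact_mod_cast hm
  calc (Φ.card : ℝ)
      ≤ ∑ I : Finset (Fin m) with m ≤ (k + 1) * I.card,
          (k : ℝ) ^ I.card * (m : ℝ) ^ (m - I.card) := by exact_mod_cast h.card_le_sum
    _ ≤ (Finset.univ.filter fun I : Finset (Fin m) => m ≤ (k + 1) * I.card).card •
          ((k : ℝ) ^ m * (m : ℝ) ^ ((k * m : ℝ) / (k + 1))) := Finset.sum_le_card_nsmul _ _ _ hterm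
    _ ≤ (2 : ℝ) ^ m * ((k : ℝ) ^ m * (m : ℝ) ^ ((k * m : ℝ) / (k + 1))) := by
        rw [nsmul_eq_mul]
        gcongr
        have := Finset.card_filter_le (Finset.univ : Finset (Finset (Fin m)))
          fun I => m ≤ (k + 1) * I.card
        rw [Finset.card_univ, Fintype.card_finset, Fintype.card_fin] at this
        exact_mod_cast this
    _ = _ := by rw [mul_pow, mul_assoc]

theorem exists_unpack_eq {m : ℕ} {w : Fin m × Fin m → Bool} (hw : w ∈ GoodM m) :
    ∃ ν, unpack ν = w := by
  choose ν hν huniq using hw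
  refine ⟨ν, funext fun ⟨i, j⟩ => ?_⟩
  rw [unpack, Bool.eq_iff_iff, decide_eq_true_iff]
  exact ⟨fun h : j = ν i => h ▸ hν i, huniq i j⟩

theorem FTangled.card_le_rpow {m k : ℕ} (hk : 1 ≤ k) (hm : 1 ≤ m)
    {F : Finset (Fin m × Fin m → Bool)} (hF : ↑F ⊆ GoodM m)
    (h : FTangled k (F : Set (Fin m × Fin m → Bool))) :
    (F.card : ℝ) ≤ (2 * k : ℝ) ^ m * (m : ℝ) ^ ((k * m : ℝ) / (k + 1)) := by
  classical
  have hT : Tangled k ((Finset.univ.filter fun ν => unpack ν ∈ F :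
      Finset (Fin m → Fin m)) : Set (Fin m → Fin m)) := by
    simpa [FTangled] using h
  refine le_trans ?_ (hT.card_le_rpow hk hm)
  have hsub : F ⊆ (Finset.univ.filter fun ν => unpack ν ∈ F).image unpack := by
    intro w hw
    obtain ⟨ν, rfl⟩ := exists_unpack_eq (hF hw)
    exact Finset.mem_image_of_mem _ (by simpa using hw)
  exact_mod_cast (Finset.card_le_card hsub).trans Finset.card_image_le

theorem FTangled.eventually_card_lt (k : ℕ) (hk : 1 ≤ k) :
    ∃ N : ℕ, ∀ m : ℕ, N ≤ m →
      ∀ F : Finset (Fin m × Fin m → Bool), ↑F ⊆ GoodM m →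
        FTangled k (↑F : Set (Fin m × Fin m → Bool)) →
        (F.card : ℝ) < (m : ℝ) ^ ((2 * k * m : ℝ) / (2 * k + 1 : ℝ)) := by
  have hk0 : (0 : ℝ) < k := by exact_mod_cast hk
  obtain ⟨δ, hδ⟩ : ∃ δ : ℝ, δ = k / ((2 * k + 1) * (k + 1)) := ⟨_, rfl⟩
  have hδ0 : 0 < δ := by rw [hδ]; positivity
  obtain ⟨N, hN⟩ := Filter.eventually_atTop.1 (((tendsto_rpow_atTop hδ0).comp
    tendsto_natCast_atTop_atTop).eventually_gt_atTop (2 * k : ℝ))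
  refine ⟨max N 1, fun m hm F hF hT => (hT.card_le_rpow hk (le_of_max_le_right hm) hF).trans_lt ?_⟩
  have hm1 : 1 ≤ m := le_of_max_le_right hm
  have hm0 : (0 : ℝ) < m := by exact_mod_cast hm1
  have hlt : (2 * k : ℝ) < (m : ℝ) ^ δ := hN m (le_of_max_le_left hm)
  calc (2 * k : ℝ) ^ m * (m : ℝ) ^ ((k * m : ℝ) / (k + 1))
      < ((m : ℝ) ^ δ) ^ m * (m : ℝ) ^ ((k * m : ℝ) / (k + 1)) := by
        gcongr
    _ = (m : ℝ) ^ ((2 * k * m : ℝ) / (2 * k + 1 : ℝ)) := by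
        rw [← Real.rpow_mul_natCast hm0.le, ← Real.rpow_add hm0, hδ]
        congr 1
        field_simp
        ring

/-- Tangled subsets of `Good_m` are small: a `k`-tangled `F ⊆ Good_m` has fewer
than `m^(2km/(2k+1))` elements, and in particular `|F|·(m·m)^d < m^m` for large `m`. -/
theorem tangled_implies_small :
    (∀ k : ℕ, 1 ≤ k → ∃ N : ℕ, ∀ m : ℕ, N ≤ m →
      ∀ F : Finset (Fin m × Fin m → Bool), ↑F ⊆ GoodM m →
        FTangled k (↑F : Set (Fin m × Fin m → Bool)) →
        (F.card : ℝ) < (m : ℝ) ^ ((2 * k * m : ℝ) / (2 * k + 1 : ℝ))) ∧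
    (∀ k : ℕ, 1 ≤ k → ∀ d : ℕ, ∃ N : ℕ, ∀ m : ℕ, N ≤ m →
      ∀ F : Finset (Fin m × Fin m → Bool), ↑F ⊆ GoodM m →
        FTangled k (↑F : Set (Fin m × Fin m → Bool)) →
        F.card * (m * m) ^ d < m ^ m) := by
  refine ⟨FTangled.eventually_card_lt, fun k hk d => ?_⟩
  obtain ⟨N, hN⟩ := FTangled.eventually_card_lt k hk
  refine ⟨max N (max 1 (2 * d * (2 * k + 1))), fun m hm F hF hT => ?_⟩
  simp only [max_le_iff] at hm
  obtain ⟨hmN, hm1, hmd⟩ := hm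
  have hm0 : (0 : ℝ) < m := by exact_mod_cast hm1
  have hmd' : (2 * d * (2 * k + 1) : ℝ) ≤ m := by exact_mod_cast hmd
  have hexp : (2 * k * m : ℝ) / (2 * k + 1) + (2 * d : ℕ) ≤ (m : ℕ) := by
    push_cast
    rw [div_add' _ _ _ (by positivity), div_le_iff₀ (by positivity)]
    linarith
  have hreal : (F.card : ℝ) * (m * m) ^ d < (m : ℝ) ^ m :=
    calc (F.card : ℝ) * (m * m) ^ d
        < (m : ℝ) ^ ((2 * k * m : ℝ) / (2 * k + 1 : ℝ)) * (m * m) ^ d := by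
          gcongr
          exact hN m hmN F hF hT
      _ = (m : ℝ) ^ ((2 * k * m : ℝ) / (2 * k + 1) + (2 * d : ℕ)) := by
          rw [Real.rpow_add hm0, Real.rpow_natCast, pow_mul, sq]
      _ ≤ (m : ℝ) ^ ((m : ℕ) : ℝ) :=
          Real.rpow_le_rpow_of_exponent_le (by exact_mod_cast hm1) hexp
      _ = (m : ℝ) ^ m := Real.rpow_natCast _ _
  exact_mod_cast hreal
end

section
/- Let m, k : ℕ with k + 1 ≤ m, and let F ⊆ Good_m. If F is not k-tangled, then there exists a word u ∈ Bad_m that is a k-limit for F. -/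
/-- A non-`k`-tangled subset of `Good_m` has a `k`-limit in `Bad_m`. -/
theorem not_tangled_implies_klimit {m k : ℕ} (hkm : k + 1 ≤ m)
    (F : Set (Fin m × Fin m → Bool)) (hF : F ⊆ GoodM m) (hnt : ¬ FTangled k F) :
    ∃ u ∈ BadM m, KLimit k F u := by
  classical
  unfold FTangled Tangled at hnt
  push Not at hnt
  obtain ⟨μ, hμ, i, hi⟩ := hnt
  refine ⟨unpackOpt (Function.update (fun j => some (μ j)) i none), ⟨i, ?_, ?_⟩, ?_⟩
  · simp [unpackOpt]
  · intro j hj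
    exact ⟨μ j, by simp [unpackOpt, hj], fun c hc => by
      simpa [unpackOpt, hj, eq_comm] using hc⟩
  · intro P hP
    by_cases hmem : (i, μ i) ∈ P
    · set D := P.filter (fun p => p.1 = i)
      set S := (P.filter (fun p => p.1 ≠ i)).image (fun p => (p.1, μ p.1))
      have hD : D.card ≤ k := (Finset.card_filter_le _ _).trans hP
      have hS : S.card ≤ k :=
        Finset.card_image_le.trans ((Finset.card_filter_le _ _).trans hP)
      have hag : Agrees μ S := by
        intro p hp
        obtain ⟨q, -, rfl⟩ := Finset.mem_image.mp hp
        rfl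
      have hne : ∀ p ∈ S, p.1 ≠ i := by
        intro p hp
        obtain ⟨q, hq, rfl⟩ := Finset.mem_image.mp hp
        exact (Finset.mem_filter.mp hq).2
      have hnot := hi D hD (fun p hp => (Finset.mem_filter.mp hp).2)
        (Finset.mem_filter.mpr ⟨hmem, rfl⟩) S hS hag
      unfold Entails at hnot
      push Not at hnot
      obtain ⟨ν, hν, hνS, hνD⟩ := hnot hne
      refine ⟨unpack ν, hν, ?_⟩
      rintro ⟨j, c⟩ hp
      by_cases hj : j = i
      · subst hj
        have := hνD c (Finset.mem_filter.mpr ⟨hp, rfl⟩)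
        simp [unpackOpt, unpack, this.symm]
      · have : ν j = μ j := hνS (j, μ j) (Finset.mem_image.mpr
          ⟨(j, c), Finset.mem_filter.mpr ⟨hp, hj⟩, rfl⟩)
        simp [unpackOpt, unpack, hj, this, eq_comm]
    · refine ⟨unpack μ, hμ, ?_⟩
      rintro ⟨j, c⟩ hp
      by_cases hj : j = i
      · subst hj
        have : c ≠ μ j := fun h => hmem (h ▸ hp)
        simp [unpackOpt, unpack, this]
      · simp [unpackOpt, unpack, hj, eq_comm]
end

section
/- There is no language L over Bool that is recognized by a Σ₂ circuit family and separates Good from Bad, i.e., with Good ⊆ L and L ∩ Bad = ∅. -/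
/-- Among all tuples `e : κ → ι`, those with `e a ∈ R (e b)` for fixed `a ≠ b` form at most
a fraction `r / |ι|`, when all the sets `R i` have at most `r` elements. -/
theorem card_filter_mem_mul_le {ι κ : Type*} [Fintype ι] [DecidableEq ι] [Fintype κ]
    [DecidableEq κ] {r : ℕ} (R : ι → Finset ι) (hR : ∀ i, (R i).card ≤ r) {a b : κ}
    (hab : a ≠ b) :
    (Finset.univ.filter fun e : κ → ι => e a ∈ R (e b)).card * Fintype.card ι ≤
      r * Fintype.card ι ^ Fintype.card κ := by
  classical
  have hfiber := Finset.card_le_mul_card_image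
    (s := Finset.univ.filter fun e : κ → ι => e a ∈ R (e b))
    (f := fun (e : κ → ι) (x : {x // x ≠ a}) => e x) r (by
      intro y _
      refine le_trans ?_ (hR (y ⟨b, hab.symm⟩))
      refine Finset.card_le_card_of_injOn (fun e => e a) ?_ ?_
      · intro e he
        simp only [Finset.coe_filter, Finset.mem_filter, Finset.mem_univ, true_and,
          Set.mem_ofPred_eq] at he
        obtain ⟨he, rfl⟩ := he
        exact he
      · intro e he e' he' h
        simp only [Finset.coe_filter, Finset.mem_filter, Finset.mem_univ, true_and,
          Set.mem_ofPred_eq] at he he'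
        funext x
        by_cases hx : x = a
        · rw [hx]; exact h
        · exact congrFun (he.2.trans he'.2.symm) ⟨x, hx⟩)
  have himage := Finset.card_le_univ
    ((Finset.univ.filter fun e : κ → ι => e a ∈ R (e b)).image
      fun (e : κ → ι) (x : {x // x ≠ a}) => e x)
  have hcard : Fintype.card {x // x ≠ a} + 1 = Fintype.card κ := by
    rw [Fintype.card_subtype_compl, Fintype.card_subtype_eq]
    have := Fintype.card_pos_iff.2 ⟨a⟩
    omega
  rw [Fintype.card_fun] at himage
  calc _ ≤ r * Fintype.card ι ^ Fintype.card {x // x ≠ a} * Fintype.card ι :=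
        Nat.mul_le_mul_right _ (hfiber.trans (Nat.mul_le_mul_left _ himage))
    _ = _ := by rw [← hcard, pow_succ, mul_assoc]

/-- Most tuples `e` avoid all the incidences `e a ∈ R (e b)` with `a ≠ b`. -/
theorem card_pow_le_two_mul_card_filter {ι κ : Type*} [Fintype ι] [DecidableEq ι] [Fintype κ]
    [DecidableEq κ] {r : ℕ} (R : ι → Finset ι) (hR : ∀ i, (R i).card ≤ r)
    (hr : 2 * (Fintype.card κ ^ 2 * r) ≤ Fintype.card ι) (hι : 0 < Fintype.card ι) :
    Fintype.card ι ^ Fintype.card κ ≤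
      2 * (Finset.univ.filter fun e : κ → ι => ∀ a b, a ≠ b → e a ∉ R (e b)).card := by
  classical
  set N := Fintype.card ι ^ Fintype.card κ
  set G := Finset.univ.filter fun e : κ → ι => ∀ a b, a ≠ b → e a ∉ R (e b) with hG
  set B := (Finset.univ.filter fun p : κ × κ => p.1 ≠ p.2).biUnion
    fun p => Finset.univ.filter fun e : κ → ι => e p.1 ∈ R (e p.2)
  have hcover : (Finset.univ : Finset (κ → ι)) ⊆ G ∪ B := by
    intro e _
    by_cases he : e ∈ G
    · exact Finset.mem_union_left _ he
    · simp only [hG, Finset.mem_filter, Finset.mem_univ, true_and, not_forall, not_not] at he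
      obtain ⟨a, b, hab, h⟩ := he
      exact Finset.mem_union_right _ (Finset.mem_biUnion.2 ⟨(a, b), by simpa using hab,
        by simpa using h⟩)
  have hsum : N ≤ G.card + B.card := by
    have := (Finset.card_le_card hcover).trans (Finset.card_union_le _ _)
    rwa [Finset.card_univ, Fintype.card_fun] at this
  have hBcard : B.card * Fintype.card ι ≤ Fintype.card κ ^ 2 * (r * N) := by
    calc B.card * Fintype.card ι
        ≤ (∑ p ∈ Finset.univ.filter fun p : κ × κ => p.1 ≠ p.2,
            (Finset.univ.filter fun e : κ → ι => e p.1 ∈ R (e p.2)).card) * Fintype.card ι :=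
          Nat.mul_le_mul_right _ Finset.card_biUnion_le
      _ ≤ (Finset.univ.filter fun p : κ × κ => p.1 ≠ p.2).card * (r * N) := by
          rw [Finset.sum_mul, ← smul_eq_mul]
          refine Finset.sum_le_card_nsmul _ _ _ fun p hp => ?_
          exact card_filter_mem_mul_le R hR (by simpa using hp)
      _ ≤ _ := by
          refine Nat.mul_le_mul_right _ ((Finset.card_le_univ _).trans ?_)
          rw [Fintype.card_prod, sq]
  have h2 : (2 * B.card) * Fintype.card ι ≤ N * Fintype.card ι := by
    calc _ = 2 * (B.card * Fintype.card ι) := by ring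
      _ ≤ 2 * (Fintype.card κ ^ 2 * (r * N)) := Nat.mul_le_mul_left _ hBcard
      _ = N * (2 * (Fintype.card κ ^ 2 * r)) := by ring
      _ ≤ _ := Nat.mul_le_mul_left _ hr
  have h3 := Nat.le_of_mul_le_mul_right h2 hι
  omega

/-- If, on the family `G`, the coordinates in the range of `e` are confined to sets of size `k`
determined by the remaining coordinates, then `G` is small. -/
theorem card_mul_pow_le_of_determined {ι α κ : Type*} [Fintype ι] [Fintype α] [Fintype κ]
    [DecidableEq α] {k : ℕ} (G : Finset (ι → α)) (e : κ → ι) (he : Function.Injective e)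
    (T : (ι → α) → ι → Finset α) (hT : ∀ g i, (T g i).card ≤ k)
    (h : ∀ g ∈ G, ∀ g' ∈ G, (∀ x, x ∉ Set.range e → g' x = g x) → ∀ a, g' (e a) ∈ T g (e a)) :
    G.card * Fintype.card α ^ Fintype.card κ ≤
      k ^ Fintype.card κ * Fintype.card α ^ Fintype.card ι := by
  classical
  have hfiber := Finset.card_le_mul_card_image (s := G)
    (f := fun (g : ι → α) (x : {x // x ∉ Set.range e}) => g x) (k ^ Fintype.card κ) (by
      intro y hy
      obtain ⟨g₀, hg₀, rfl⟩ := Finset.mem_image.1 hy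
      calc _ ≤ (Fintype.piFinset fun a => T g₀ (e a)).card := by
            refine Finset.card_le_card_of_injOn (fun g a => g (e a)) ?_ ?_
            · intro g hg
              simp only [Finset.coe_filter, Set.mem_ofPred_eq] at hg
              simp only [Finset.mem_coe, Fintype.mem_piFinset]
              exact h g₀ hg₀ g hg.1 fun x hx => congrFun hg.2 ⟨x, hx⟩
            · intro g hg g' hg' hgg'
              simp only [Finset.coe_filter, Set.mem_ofPred_eq] at hg hg'
              funext x
              by_cases hx : x ∈ Set.range e
              · obtain ⟨a, rfl⟩ := hx
                exact congrFun hgg' a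
              · exact congrFun (hg.2.trans hg'.2.symm) ⟨x, hx⟩
        _ ≤ k ^ Fintype.card κ := by
            rw [Fintype.card_piFinset, ← Finset.card_univ]
            exact Finset.prod_le_pow_card _ _ _ fun a _ => hT _ _)
  have himage := Finset.card_le_univ
    (G.image fun (g : ι → α) (x : {x // x ∉ Set.range e}) => g x)
  rw [Fintype.card_fun] at himage
  have hcard : Fintype.card {x // x ∉ Set.range e} + Fintype.card κ = Fintype.card ι := by
    have h1 := Fintype.card_subtype_compl (fun x => x ∈ Set.range e)
    have h2 : Fintype.card {x // x ∈ Set.range e} = Fintype.card κ :=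
      (Fintype.card_congr (Equiv.ofInjective e he)).symm
    have h3 := Fintype.card_le_of_injective e he
    omega
  calc _ ≤ k ^ Fintype.card κ * Fintype.card α ^ Fintype.card {x // x ∉ Set.range e} *
          Fintype.card α ^ Fintype.card κ :=
        Nat.mul_le_mul_right _ (hfiber.trans (Nat.mul_le_mul_left _ himage))
    _ = _ := by rw [← hcard, pow_add, mul_assoc]

/-- A family of functions `ι → α` in which every coordinate of every member is confined to `k`
values by at most `k` other coordinates is small. -/
theorem card_mul_pow_le_of_locally_confined {ι α : Type*} [Fintype ι] [DecidableEq ι]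
    [Fintype α] [DecidableEq α] {k D : ℕ} (F : Finset (ι → α))
    (S : (ι → α) → ι → Finset ι) (T : (ι → α) → ι → Finset α)
    (hS : ∀ g i, (S g i).card ≤ k) (hT : ∀ g i, (T g i).card ≤ k)
    (hSi : ∀ g i, i ∉ S g i)
    (h : ∀ g ∈ F, ∀ g' ∈ F, ∀ i, (∀ x ∈ S g i, g' x = g x) → g' i ∈ T g i)
    (hD : 2 * (D ^ 2 * (k + 1)) ≤ Fintype.card ι) (hι : 0 < Fintype.card ι) :
    F.card * Fintype.card α ^ D ≤ 2 * (k ^ D * Fintype.card α ^ Fintype.card ι) := by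
  classical
  rcases F.eq_empty_or_nonempty with rfl | hF
  · simp
  let good : (ι → α) → (Fin D → ι) → Prop := fun g e =>
    ∀ a b, a ≠ b → e a ∉ insert (e b) (S g (e b))
  obtain ⟨e, hle⟩ : ∃ e : Fin D → ι, F.card ≤ 2 * (F.filter fun g => good g e).card := by
    by_contra! hcon
    have hdouble := Finset.sum_card_bipartiteAbove_eq_sum_card_bipartiteBelow
      (s := F) (t := (Finset.univ : Finset (Fin D → ι))) good
    have hne : (Finset.univ : Finset (Fin D → ι)).Nonempty :=
      haveI : Nonempty ι := Fintype.card_pos_iff.1 hι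
      Finset.univ_nonempty
    have hlt : ∑ e : Fin D → ι, 2 * (F.filter fun g => good g e).card <
        ∑ _e : Fin D → ι, F.card := Finset.sum_lt_sum_of_nonempty hne fun e _ => hcon e
    have hge : ∑ _g ∈ F, Fintype.card ι ^ D ≤
        ∑ g ∈ F, 2 * (Finset.univ.filter fun e => good g e).card := by
      refine Finset.sum_le_sum fun g _ => ?_
      have := card_pow_le_two_mul_card_filter (κ := Fin D) (fun i => insert i (S g i))
        (r := k + 1)
        (fun i => (Finset.card_insert_le _ _).trans (Nat.add_le_add_right (hS g i) 1))
        (by simpa using hD) hι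
      simpa [good] using this
    rw [← Finset.mul_sum] at hlt hge
    simp only [Finset.bipartiteAbove, Finset.bipartiteBelow] at hdouble
    rw [hdouble] at hge
    simp only [Finset.sum_const, Finset.card_univ, Fintype.card_fun, Fintype.card_fin,
      smul_eq_mul] at hlt hge
    rw [mul_comm] at hge
    omega
  have hpos : 0 < (F.filter fun g => good g e).card := by
    have := hF.card_pos
    omega
  obtain ⟨g₀, hg₀⟩ := Finset.card_pos.1 hpos
  have hinj : Function.Injective e := by
    intro a b hab
    by_contra hne
    exact (Finset.mem_filter.1 hg₀).2 a b hne (hab ▸ Finset.mem_insert_self _ _)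
  have hsmall := card_mul_pow_le_of_determined (k := k) (F.filter fun g => good g e) e hinj T hT
    (by
      intro g hg g' hg' hagree a
      rw [Finset.mem_filter] at hg hg'
      refine h g hg.1 g' hg'.1 _ fun x hx => hagree x ?_
      rintro ⟨b, rfl⟩
      by_cases hba : b = a
      · subst hba
        exact hSi _ _ hx
      · exact hg.2 b a hba (Finset.mem_insert_of_mem hx))
  rw [Fintype.card_fin] at hsmall
  calc _ ≤ 2 * (F.filter fun g => good g e).card * Fintype.card α ^ D :=
        Nat.mul_le_mul_right _ hle
    _ = 2 * ((F.filter fun g => good g e).card * Fintype.card α ^ D) := by ring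
    _ ≤ _ := Nat.mul_le_mul_left _ hsmall

/-- The word whose `i`-th block has its unique `true` at position `f i`. -/
def graphWord {m : ℕ} (f : Fin m → Fin m) : Fin m × Fin m → Bool :=
  fun p => decide (f p.1 = p.2)

/-- The word of `f` with the block `i` made entirely `false`. -/
def clearedWord {m : ℕ} (f : Fin m → Fin m) (i : Fin m) : Fin m × Fin m → Bool :=
  fun p => decide (p.1 ≠ i ∧ f p.1 = p.2)

theorem graphWord_mem_goodM {m : ℕ} (f : Fin m → Fin m) : graphWord f ∈ GoodM m := by
  intro i
  exact ⟨f i, by simp [graphWord], fun j hj => by simpa [graphWord, eq_comm] using hj⟩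

theorem clearedWord_mem_badM {m : ℕ} (f : Fin m → Fin m) (i : Fin m) :
    clearedWord f i ∈ BadM m := by
  refine ⟨i, fun j => by simp [clearedWord], fun i' hi' => ?_⟩
  exact ⟨f i', by simp [clearedWord, hi'],
    fun j hj => by simpa [clearedWord, hi', eq_comm] using hj⟩

/-- A set of good words without a bad `k`-limit of the form `clearedWord f i` is small. -/
theorem card_mul_pow_le_of_not_kLimit {m k D : ℕ} (F : Finset (Fin m → Fin m))
    (hF : ∀ f ∈ F, ∀ i, ¬ KLimit k (Set.image graphWord F) (clearedWord f i))
    (hD : 2 * (D ^ 2 * (k + 1)) ≤ m) (hm : 0 < m) :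
    F.card * m ^ D ≤ 2 * (k ^ D * m ^ m) := by
  classical
  have hex : ∀ f i, ∃ P : Finset (Fin m × Fin m), P.card ≤ k ∧
      (f ∈ F → ∀ f' ∈ F, ¬ ∀ p ∈ P, clearedWord f i p = graphWord f' p) := by
    intro f i
    by_cases hf : f ∈ F
    · have := hF f hf i
      simp only [KLimit, not_forall, exists_prop] at this
      obtain ⟨P, hP, hno⟩ := this
      exact ⟨P, hP, fun _ f' hf' hall => hno ⟨_, ⟨f', hf', rfl⟩, hall⟩⟩
    · exact ⟨∅, by simp, fun h => absurd h hf⟩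
  choose P hP hno using hex
  have := card_mul_pow_le_of_locally_confined (k := k) (D := D) F
    (fun f i => ((P f i).image Prod.fst).erase i) (fun f i => (P f i).image Prod.snd)
    (fun f i => (Finset.card_erase_le.trans Finset.card_image_le).trans (hP f i))
    (fun f i => Finset.card_image_le.trans (hP f i))
    (fun f i => Finset.notMem_erase _ _)
    (by
      intro f hf f' hf' i hagree
      by_contra hmem
      refine hno f i hf f' hf' fun p hp => ?_
      by_cases hpi : p.1 = i
      · have : f' i ≠ p.2 := fun h => hmem (h ▸ Finset.mem_image_of_mem _ hp)
        simp [clearedWord, graphWord, hpi, this]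
      · have := hagree p.1 (Finset.mem_erase.2 ⟨hpi, Finset.mem_image_of_mem _ hp⟩)
        simp [clearedWord, graphWord, hpi, this])
    (by simpa using hD) (by simpa using hm)
  simpa using this

/-- `KLocal` predicates stay `k`-local under reindexing of the positions. -/
theorem KLocal.comp_equiv {ι ι' A : Type*} {k : ℕ} {g : (ι → A) → Prop} (hg : KLocal k g)
    (σ : ι ≃ ι') : KLocal k fun w : ι' → A => g (w ∘ σ) := by
  obtain ⟨P, hP, h⟩ := hg
  refine ⟨P.map σ.toEmbedding, by simpa using hP, fun w v hwv => h _ _ fun p hp => ?_⟩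
  exact hwv _ (by simpa using hp)

/-- Σ₂-circuits can be reindexed along a bijection of the positions. -/
theorem Sigma2Circuit.comp_equiv {ι ι' A : Type*} {s k : ℕ} {C : (ι → A) → Prop}
    (hC : Sigma2Circuit s k C) (σ : ι ≃ ι') :
    Sigma2Circuit s k fun w : ι' → A => C (w ∘ σ) := by
  obtain ⟨s', hs', J, g, hg, h⟩ := hC
  exact ⟨s', hs', J, fun i j w => g i j (w ∘ σ), fun i j => (hg i j).comp_equiv σ,
    fun w => h _⟩

/-- A Σ₂-circuit accepting all good words and no bad words is large. -/
theorem pow_le_of_sigma2Circuit_separates {m s k D : ℕ} {C : (Fin m × Fin m → Bool) → Prop}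
    (hC : Sigma2Circuit s k C) (hgood : ∀ w ∈ GoodM m, C w) (hbad : ∀ w ∈ BadM m, ¬ C w)
    (hD : 2 * (D ^ 2 * (k + 1)) ≤ m) (hm : 0 < m) :
    m ^ D ≤ s * (2 * k ^ D) := by
  classical
  obtain ⟨s', hs', J, g, hg, h⟩ := hC
  have hacc : ∀ f : Fin m → Fin m, ∃ i, ∀ j, g i j (graphWord f) := fun f =>
    (h _).1 (hgood _ (graphWord_mem_goodM f))
  choose c hc using hacc
  have hfib : ∀ i : Fin s', (Finset.univ.filter fun f => c f = i).card * m ^ D ≤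
      2 * (k ^ D * m ^ m) := by
    intro i
    refine card_mul_pow_le_of_not_kLimit _ (fun f _ b hlim => ?_) hD hm
    refine hbad _ (clearedWord_mem_badM f b) ((h _).2 ⟨i, fun j => ?_⟩)
    obtain ⟨P, hP, hloc⟩ := hg i j
    obtain ⟨_, ⟨f', hf', rfl⟩, hagree⟩ := hlim P hP
    simp only [Finset.coe_filter, Finset.mem_univ, true_and, Set.mem_ofPred_eq] at hf'
    subst hf'
    exact (hloc _ _ hagree).2 (hc f' j)
  have hcount := Finset.card_eq_sum_card_fiberwise (f := c)
    (s := (Finset.univ : Finset (Fin m → Fin m))) (t := Finset.univ) (fun _ _ => by simp)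
  have hsum : (∑ i : Fin s', (Finset.univ.filter fun f => c f = i).card) * m ^ D ≤
      s' * (2 * (k ^ D * m ^ m)) := by
    rw [Finset.sum_mul]
    refine (Finset.sum_le_card_nsmul _ _ _ fun i _ => hfib i).trans ?_
    simp
  rw [← hcount, Finset.card_univ, Fintype.card_fun, Fintype.card_fin] at hsum
  have hle : m ^ D * m ^ m ≤ (s * (2 * k ^ D)) * m ^ m := by
    calc m ^ D * m ^ m = m ^ m * m ^ D := mul_comm _ _
      _ ≤ s' * (2 * (k ^ D * m ^ m)) := hsum
      _ ≤ s * (2 * (k ^ D * m ^ m)) := Nat.mul_le_mul_right _ hs'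
      _ = _ := by ring
  exact Nat.le_of_mul_le_mul_right hle (pow_pos hm m)

theorem listToWord_ofFn {m : ℕ} (u : Fin m × Fin m → Bool)
    (h : (List.ofFn (u ∘ finProdFinEquiv.symm)).length = m * m) :
    listToWord m (List.ofFn (u ∘ finProdFinEquiv.symm)) h = u := by
  funext p
  have hp : ∀ hlt, (⟨p.1 * m + p.2, hlt⟩ : Fin (m * m)) = finProdFinEquiv p := by
    intro hlt
    ext
    simp [finProdFinEquiv, add_comm, mul_comm]
  simp [listToWord, hp]

/-- No language recognized by a Σ₂ circuit family separates `Good` from `Bad`,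
i.e. contains all of `Good` and is disjoint from `Bad`. -/
theorem no_sigma2_separates_good_bad :
    ¬ ∃ L : Language Bool, RecSigma2 L ∧
      {w : List Bool | w ∈ GoodLang} ⊆ {w : List Bool | w ∈ L} ∧
      {w : List Bool | w ∈ L} ∩ {w : List Bool | w ∈ BadLang} = ∅ := by
  rintro ⟨L, ⟨k, c, d, hrec⟩, hgood, hbad⟩
  set D := 2 * d + 1 with hDdef
  set m := 2 ^ (d + 1) * c * k ^ D + 2 * (D ^ 2 * (k + 1)) + 1 with hmdef
  have hm : 0 < m := Nat.succ_pos _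
  obtain ⟨C, hC, hCL⟩ := hrec (m * m)
  have hsize := pow_le_of_sigma2Circuit_separates (D := D)
    (hC.comp_equiv finProdFinEquiv.symm)
    (fun u hu => (hCL _).2 (hgood ⟨m, List.length_ofFn, by rwa [listToWord_ofFn]⟩))
    (fun u hu hCu => Set.eq_empty_iff_forall_notMem.1 hbad _
      ⟨(hCL _).1 hCu, ⟨m, List.length_ofFn, by rwa [listToWord_ofFn]⟩⟩)
    (by omega) hm
  have hpoly : (m * m + 1) ^ d ≤ 2 ^ d * m ^ (2 * d) := by
    rw [pow_mul, ← mul_pow]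
    exact Nat.pow_le_pow_left (by nlinarith) d
  have hle : m * m ^ (2 * d) ≤ (2 ^ (d + 1) * c * k ^ D) * m ^ (2 * d) := by
    calc m * m ^ (2 * d) = m ^ D := by rw [hDdef, pow_succ, mul_comm]
      _ ≤ c * (m * m + 1) ^ d * (2 * k ^ D) := hsize
      _ ≤ c * (2 ^ d * m ^ (2 * d)) * (2 * k ^ D) :=
          Nat.mul_le_mul_right _ (Nat.mul_le_mul_left _ hpoly)
      _ = _ := by ring
  have := Nat.le_of_mul_le_mul_right hle (pow_pos hm _)
  omega
end

section
/- Let M be a finite ordered monoid, and let x, y ∈ M be such that x·x = x, y is a subword of x, and ¬(x ≤ x·y·x). Then the up-word problem of M for x, namely the language T = {w : List M | x ≤ w.prod} over the alphabet M, is not recognized by any Σ₂ circuit family. -/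
section Masking

variable {ι α : Type*} [DecidableEq ι]

/-- The partial function that remembers `f` only at the coordinates in `W`. -/
def maskTo (W : Finset ι) (f : ι → α) : ι → Option α :=
  fun b => if b ∈ W then some (f b) else none

theorem maskTo_eq_iff {W : Finset ι} {f h : ι → α} :
    maskTo W f = maskTo W h ↔ ∀ b ∈ W, f b = h b := by
  constructor
  · intro e b hb
    have := congrFun e b
    simpa [maskTo, hb] using this
  · intro e
    funext b
    by_cases hb : b ∈ W
    · simp [maskTo, hb, e b hb]
    · simp [maskTo, hb]

variable [Fintype ι] [DecidableEq α]

/-- If on `G` the coordinates in `W` determine coordinate `b` up to `q` values, then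
adding `b` to `W` multiplies the number of masked functions by at most `q`. -/
theorem card_image_maskTo_insert_le (G : Finset (ι → α)) (W : Finset ι) (b : ι) (q : ℕ)
    (hG : ∀ f ∈ G, ∃ Q : Finset α, Q.card ≤ q ∧
      ∀ h ∈ G, (∀ a ∈ W, h a = f a) → h b ∈ Q) :
    (G.image (maskTo (insert b W))).card ≤ q * (G.image (maskTo W)).card := by
  have key : (G.image (maskTo (insert b W))).image
      (fun φ a => if a ∈ W then φ a else none) = G.image (maskTo W) := by
    rw [Finset.image_image]
    congr 1
    funext f a
    by_cases ha : a ∈ W <;> simp [maskTo, ha]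
  rw [← key]
  refine Finset.card_le_mul_card_image _ _ fun φ hφ => ?_
  rw [key] at hφ
  obtain ⟨f, hf, rfl⟩ := Finset.mem_image.1 hφ
  obtain ⟨Q, hQ, hdet⟩ := hG f hf
  refine le_trans ?_ hQ
  rw [← Finset.card_image_of_injective Q (Option.some_injective α)]
  have mask_insert : ∀ h : ι → α,
      (fun a => if a ∈ W then maskTo (insert b W) h a else none) = maskTo W h := by
    intro h
    funext a
    by_cases ha : a ∈ W <;> simp [maskTo, ha]
  refine Finset.card_le_card_of_injOn (fun φ => φ b) ?_ ?_
  · intro ψ hψ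
    obtain ⟨hψ, e⟩ := Finset.mem_filter.1 hψ
    obtain ⟨h, hh, rfl⟩ := Finset.mem_image.1 hψ
    rw [mask_insert, maskTo_eq_iff] at e
    simpa [maskTo] using hdet h hh e
  · intro ψ₁ h₁ ψ₂ h₂ e
    obtain ⟨h₁, e₁⟩ := Finset.mem_filter.1 h₁
    obtain ⟨h₂, e₂⟩ := Finset.mem_filter.1 h₂
    obtain ⟨f₁, -, rfl⟩ := Finset.mem_image.1 h₁
    obtain ⟨f₂, -, rfl⟩ := Finset.mem_image.1 h₂
    rw [mask_insert, maskTo_eq_iff] at e₁ e₂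
    rw [maskTo_eq_iff]
    intro a ha
    rcases Finset.mem_insert.1 ha with rfl | ha
    · simpa [maskTo] using e
    · rw [e₁ a ha, e₂ a ha]

theorem card_image_maskTo_union_mul_le [Fintype α] (G : Finset (ι → α)) (W T : Finset ι)
    (r K : ℕ) (hW : (G.image (maskTo W)).card * Fintype.card α ^ r
      ≤ K * Fintype.card α ^ W.card) :
    (G.image (maskTo (T ∪ W))).card * Fintype.card α ^ r
      ≤ K * Fintype.card α ^ (T ∪ W).card := by
  induction T using Finset.induction_on with
  | empty => simpa using hW
  | insert b T _ ih =>
    rw [Finset.insert_union]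
    by_cases hb : b ∈ T ∪ W
    · rwa [Finset.insert_eq_of_mem hb]
    · have h := card_image_maskTo_insert_le G (T ∪ W) b (Fintype.card α)
        fun f _ => ⟨Finset.univ, le_rfl, fun _ _ _ => Finset.mem_univ _⟩
      rw [Finset.card_insert_of_notMem hb, pow_succ]
      calc _ ≤ Fintype.card α * (G.image (maskTo (T ∪ W))).card * Fintype.card α ^ r :=
            Nat.mul_le_mul_right _ h
        _ = (G.image (maskTo (T ∪ W))).card * Fintype.card α ^ r * Fintype.card α := by ring
        _ ≤ _ := Nat.mul_le_mul_right _ ih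
        _ = _ := by ring

/-- If on `G` every coordinate `a` is determined up to `k` values by a set `S a` of at most `k`
other coordinates, then `G` is small. -/
theorem card_mul_pow_le_of_determined_s10 [Fintype α] {k R : ℕ}
    (hD : R * (k + 1) ≤ Fintype.card ι) (G : Finset (ι → α)) (S : ι → Finset ι)
    (hS : ∀ a, a ∉ S a) (hSk : ∀ a, (S a).card ≤ k)
    (hG : ∀ f ∈ G, ∀ a, ∃ Q : Finset α, Q.card ≤ k ∧
      ∀ h ∈ G, (∀ b ∈ S a, h b = f b) → h a ∈ Q) :
    G.card * Fintype.card α ^ R ≤ k ^ R * Fintype.card α ^ Fintype.card ι := by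
  have greedy : ∀ r ≤ R, ∃ W : Finset ι, W.card ≤ r * (k + 1) ∧
      (G.image (maskTo W)).card * Fintype.card α ^ r ≤ k ^ r * Fintype.card α ^ W.card := by
    intro r
    induction r with
    | zero =>
      intro _
      refine ⟨∅, by simp, ?_⟩
      have : (G.image (maskTo (∅ : Finset ι))).card ≤ 1 :=
        Finset.card_le_one.2 fun φ hφ ψ hψ => by
          obtain ⟨f, -, rfl⟩ := Finset.mem_image.1 hφ
          obtain ⟨h, -, rfl⟩ := Finset.mem_image.1 hψ
          simp [maskTo_eq_iff]
      simpa using this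
    | succ r ih =>
      intro hr
      obtain ⟨W, hWc, hW⟩ := ih (by omega)
      have hlt : W.card < Fintype.card ι := by
        have : (r + 1) * (k + 1) ≤ R * (k + 1) := Nat.mul_le_mul_right _ hr
        have e : (r + 1) * (k + 1) = r * (k + 1) + (k + 1) := by ring
        omega
      obtain ⟨b, -, hb⟩ := Finset.exists_mem_notMem_of_card_lt_card
        (t := Finset.univ) (s := W) (by simpa using hlt)
      have hbW : b ∉ S b ∪ W := by simp [hb, hS b]
      refine ⟨insert b (S b ∪ W), ?_, ?_⟩
      · have := Finset.card_insert_le b (S b ∪ W)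
        have := Finset.card_union_le (S b) W
        have := hSk b
        have e : (r + 1) * (k + 1) = r * (k + 1) + (k + 1) := by ring
        omega
      · have h₁ := card_image_maskTo_union_mul_le G W (S b) r (k ^ r) hW
        have h₂ := card_image_maskTo_insert_le G (S b ∪ W) b k fun f hf => by
          obtain ⟨Q, hQ, h⟩ := hG f hf b
          exact ⟨Q, hQ, fun g hg e => h g hg fun a ha => e a (Finset.mem_union_left _ ha)⟩
        rw [Finset.card_insert_of_notMem hbW]
        calc _ ≤ k * (G.image (maskTo (S b ∪ W))).card * Fintype.card α ^ (r + 1) :=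
              Nat.mul_le_mul_right _ h₂
          _ = (G.image (maskTo (S b ∪ W))).card * Fintype.card α ^ r
                * (k * Fintype.card α) := by ring
          _ ≤ _ := Nat.mul_le_mul_right _ h₁
          _ = _ := by ring
  obtain ⟨W, -, hW⟩ := greedy R le_rfl
  have h := card_image_maskTo_union_mul_le G W Finset.univ R (k ^ R) hW
  rw [Finset.union_eq_left.2 (Finset.subset_univ W), Finset.card_image_of_injective _ fun f h e => funext fun a =>
    maskTo_eq_iff.1 e a (Finset.mem_univ a)] at h
  simpa using h

/-- As `card_mul_pow_le_of_determined`, where the determining coordinates may depend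
on the function. -/
theorem card_mul_pow_le_of_locally_determined [Fintype α] {k R : ℕ}
    (hD : R * (k + 1) ≤ Fintype.card ι) (G : Finset (ι → α))
    (hG : ∀ f ∈ G, ∀ a, ∃ S : Finset ι, a ∉ S ∧ S.card ≤ k ∧ ∃ Q : Finset α, Q.card ≤ k ∧
      ∀ h ∈ G, (∀ b ∈ S, h b = f b) → h a ∈ Q) :
    G.card * Fintype.card α ^ R ≤
      Fintype.card (ι → Finset ι) * (k ^ R * Fintype.card α ^ Fintype.card ι) := by
  classical
  have hG' : ∀ f, ∃ S : ι → Finset ι, f ∈ G → ∀ a, a ∉ S a ∧ (S a).card ≤ k ∧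
      ∃ Q : Finset α, Q.card ≤ k ∧ ∀ h ∈ G, (∀ b ∈ S a, h b = f b) → h a ∈ Q := by
    intro f
    by_cases hf : f ∈ G
    · choose S hS using hG f hf
      exact ⟨S, fun _ => hS⟩
    · exact ⟨fun _ => ∅, fun h => absurd h hf⟩
  choose S hS using hG'
  rw [Finset.card_eq_sum_card_fiberwise (f := S) (t := Finset.univ)
    (fun _ _ => Finset.mem_coe.2 (Finset.mem_univ _)), Finset.sum_mul, ← Finset.card_univ,
    ← smul_eq_mul]
  refine Finset.sum_le_card_nsmul _ _ _ fun σ _ => ?_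
  rcases (G.filter fun f => S f = σ).eq_empty_or_nonempty with he | ⟨f₀, hf₀⟩
  · simp [he]
  · obtain ⟨hfG, rfl⟩ := Finset.mem_filter.1 hf₀
    refine card_mul_pow_le_of_determined_s10 hD _ (S f₀) (fun a => (hS f₀ hfG a).1)
      (fun a => (hS f₀ hfG a).2.1) fun f hf a => ?_
    obtain ⟨hf, e⟩ := Finset.mem_filter.1 hf
    obtain ⟨-, -, Q, hQ, h⟩ := hS f hf a
    exact ⟨Q, hQ, fun g hg eg => h g (Finset.mem_filter.1 hg).1 (by rwa [e])⟩

end Masking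

section Words

variable {M : Type*} [Monoid M]

/-- A word pattern with one parameter in `Option α`: the all-neutral setting gives the subword
`v`, and any other setting gives the word `u`. -/
theorem exists_pattern_of_sublist {α : Type*} [Fintype α] [DecidableEq α] [Nonempty α]
    {u v : List M} (h : v.Sublist u) :
    ∃ B : List (α × M × M), B.length ≤ Fintype.card α * u.length ∧
      ∀ o : Option α, (B.map fun q => if o = some q.1 then q.2.1 else q.2.2).prod =
        if o = none then v.prod else u.prod := by
  induction h with
  | slnil => exact ⟨[], by simp, by simp⟩
  | @cons l₁ l₂ a _ ih =>
    obtain ⟨B, hB, h⟩ := ih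
    refine ⟨(Finset.univ : Finset α).toList.map (fun t => (t, a, 1)) ++ B, ?_, fun o => ?_⟩
    · simp only [List.length_append, List.length_map, Finset.length_toList, Finset.card_univ,
        List.length_cons]
      linarith
    · rw [List.map_append, List.prod_append, h, List.map_map]
      cases o with
      | none => simp [Function.comp_def]
      | some s =>
        rw [List.prod_map_eq_pow_single s]
        · simp [List.count_eq_one_of_mem (Finset.nodup_toList _)
            (Finset.mem_toList.2 (Finset.mem_univ s))]
        · intro t ht _
          simp [Ne.symm ht]
  | @cons_cons l₁ l₂ a _ ih =>
    obtain ⟨B, hB, h⟩ := ih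
    refine ⟨(Classical.arbitrary α, a, a) :: B, ?_, fun o => ?_⟩
    · have : 0 < Fintype.card α := Fintype.card_pos
      simp only [List.length_cons]
      linarith
    · rw [List.map_cons, List.prod_cons, h]
      cases o <;> simp

theorem prod_map_const_of_idempotent {β : Type*} {x : M} (hx : x * x = x) {l : List β}
    (hl : l ≠ []) : (l.map fun _ => x).prod = x := by
  induction l with
  | nil => exact absurd rfl hl
  | cons a l ih =>
    rcases eq_or_ne l [] with rfl | h
    · simp
    · rw [List.map_cons, List.prod_cons, ih h, hx]

theorem prod_map_ite_eq_of_absorbing {β : Type*} [DecidableEq β] {x z : M} (hxz : x * z = z)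
    (hzx : z * x = z) (a : β) {l : List β} (hl : l.Nodup) (ha : a ∈ l) :
    (l.map fun b => if b = a then z else x).prod = z := by
  have aux : ∀ l : List β, a ∉ l → z * (l.map fun b => if b = a then z else x).prod = z := by
    intro l
    induction l with
    | nil => simp
    | cons b l ih =>
      intro h
      rw [List.mem_cons, not_or] at h
      simp [Ne.symm h.1, ← mul_assoc, hzx, ih h.2]
  induction l with
  | nil => simp at ha
  | cons b l ih =>
    rw [List.nodup_cons] at hl
    rcases eq_or_ne b a with rfl | hba
    · simpa using aux l hl.1
    · have : a ∈ l := (List.mem_cons.1 ha).resolve_left hba.symm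
      simp [hba, ih hl.2 this, hxz]

/-- A word pattern with `D` parameters in `Option α`: its value is `x` when no parameter is
neutral, and `z` when exactly one is. -/
theorem exists_pattern_power {α : Type*} [Fintype α] [DecidableEq α] [Nonempty α]
    {x z : M} (hx : x * x = x) (hxz : x * z = z) (hzx : z * x = z) {u v : List M}
    (h : v.Sublist u) (hu : u.prod = x) (hv : v.prod = z) {D : ℕ} (hD : 0 < D) :
    ∃ L : List (Fin D × α × M × M), L.length ≤ D * (Fintype.card α * u.length) ∧
      (∀ f : Fin D → α, (L.map fun q =>
        if some (f q.1) = some q.2.1 then q.2.2.1 else q.2.2.2).prod = x) ∧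
      ∀ (f : Fin D → α) (a : Fin D), (L.map fun q =>
        if (if q.1 = a then none else some (f q.1)) = some q.2.1
          then q.2.2.1 else q.2.2.2).prod = z := by
  obtain ⟨B, hB, hprod⟩ := exists_pattern_of_sublist (α := α) h
  have eval : ∀ φ : Fin D → Option α,
      (((List.finRange D).flatMap fun i => B.map fun q => (i, q)).map fun q =>
        if φ q.1 = some q.2.1 then q.2.2.1 else q.2.2.2).prod =
      ((List.finRange D).map fun i => if φ i = none then z else x).prod := by
    intro φ
    rw [List.map_flatMap, List.flatMap_def, List.prod_flatten, List.map_map]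
    congr 2
    funext i
    simp only [Function.comp_def, List.map_map]
    rw [hprod, hu, hv]
  refine ⟨(List.finRange D).flatMap fun i => B.map fun q => (i, q), ?_, fun f => ?_,
    fun f a => ?_⟩
  · simp only [List.length_flatMap, List.length_map, List.map_const', List.length_finRange,
      List.sum_replicate, smul_eq_mul]
    exact Nat.mul_le_mul_left _ hB
  · rw [eval fun i => some (f i)]
    have hne : List.finRange D ≠ [] := by
      simpa [List.finRange_eq_nil_iff] using hD.ne'
    simpa using prod_map_const_of_idempotent hx hne
  · rw [eval fun i => if i = a then none else some (f i)]
    simpa using prod_map_ite_eq_of_absorbing hxz hzx a (List.nodup_finRange D)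
      (List.mem_finRange a)

end Words

/-- The up-word problem of a finite ordered monoid for an idempotent `x` having a
subword `y` with `¬ x ≤ x·y·x` is not recognized by any Σ₂ circuit family. -/
theorem upword_not_recSigma2 {M : Type*} [Monoid M] [Fintype M]
    [PartialOrder M] [CovariantClass M M (· * ·) (· ≤ ·)]
    [CovariantClass M M (Function.swap (· * ·)) (· ≤ ·)]
    (x y : M) (hx : x * x = x) (hsub : IsSubwordOf y x) (hneq : ¬ x ≤ x * y * x) :
    ¬ RecSigma2 ({w : List M | x ≤ w.prod} : Language M) := by
  classical
  rintro ⟨k, c, d, H⟩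
  obtain ⟨u, v, huv, hu, hv⟩ := hsub
  set m := (u ++ u ++ u).length
  set D := (d + 1) * (k + 1) with hDdef
  set K := Fintype.card (Fin D → Finset (Fin D))
  set N := c * (D * m + 1) ^ d * K * k ^ (d + 1) + 1 with hN
  obtain ⟨L, hlen, hgood, hbad⟩ := exists_pattern_power (α := Fin N) (x := x) (z := x * y * x)
    (u := u ++ u ++ u) (v := u ++ v ++ u) (D := D) hx (by simp only [← mul_assoc, hx])
    (by rw [mul_assoc, hx])
    (((List.Sublist.refl u).append huv).append (List.Sublist.refl u))
    (by simp [hu, hx]) (by simp [hu, hv, mul_assoc]) (by positivity)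
  obtain ⟨C, ⟨s', hs', J, g, hloc, hCg⟩, hCL⟩ := H L.length
  have mem_iff : ∀ φ : Fin D × Fin N × M × M → M,
      C (fun p => φ (L.get p)) ↔ x ≤ (L.map φ).prod := by
    intro φ
    rw [hCL]
    have e : List.ofFn (fun p => φ (L.get p)) = L.map φ := List.ofFn_getElem_eq_map L φ
    rw [e]
    rfl
  let word : (Fin D → Option (Fin N)) → Fin L.length → M := fun φ p =>
    if φ (L.get p).1 = some (L.get p).2.1 then (L.get p).2.2.1 else (L.get p).2.2.2
  have accept : ∀ f : Fin D → Fin N, C (word fun i => some (f i)) := fun f =>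
    (mem_iff fun q => if some (f q.1) = some q.2.1 then q.2.2.1 else q.2.2.2).2 (hgood f).ge
  have reject : ∀ (f : Fin D → Fin N) (a : Fin D),
      ¬ C (word fun i => if i = a then none else some (f i)) := fun f a hC =>
    hneq <| (hbad f a) ▸ (mem_iff fun q => if (if q.1 = a then none else some (f q.1)) =
      some q.2.1 then q.2.2.1 else q.2.2.2).1 hC
  let G : Fin s' → Finset (Fin D → Fin N) := fun i =>
    Finset.univ.filter fun f => ∀ j, g i j (word fun b => some (f b))
  have hGcard : ∀ i, (G i).card * N ^ (d + 1) ≤ K * (k ^ (d + 1) * N ^ D) := by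
    intro i
    have := card_mul_pow_le_of_locally_determined (k := k) (R := d + 1) (by simp [hDdef]) (G i)
      fun f _ a => by
        obtain ⟨j, hj⟩ : ∃ j, ¬ g i j (word fun b => if b = a then none else some (f b)) := by
          by_contra! hall
          exact reject f a ((hCg _).2 ⟨i, hall⟩)
        obtain ⟨P, hP, hPloc⟩ := hloc i j
        refine ⟨(P.image fun p => (L.get p).1).erase a, Finset.notMem_erase _ _,
          (Finset.card_erase_le.trans Finset.card_image_le).trans hP,
          P.image fun p => (L.get p).2.1, Finset.card_image_le.trans hP, fun h hh e => ?_⟩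
        by_contra hQ
        refine hj ((hPloc _ _ fun p hp => ?_).2 ((Finset.mem_filter.1 hh).2 j))
        by_cases hpa : (L.get p).1 = a
        · have hne : h a ≠ (L.get p).2.1 := fun he =>
            hQ (he ▸ Finset.mem_image_of_mem (fun p => (L.get p).2.1) hp)
          simp only [word, hpa, Option.some_inj, if_neg hne]
          simp
        · have := e _ (Finset.mem_erase.2
            ⟨hpa, Finset.mem_image_of_mem (fun p => (L.get p).1) hp⟩)
          simp only [word, if_neg hpa, this]
    simpa only [Fintype.card_fin] using this
  have hcover : N ^ D ≤ ∑ i, (G i).card := by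
    have hu : (Finset.univ : Finset (Fin D → Fin N)) ⊆ Finset.univ.biUnion G := by
      intro f _
      obtain ⟨i, hi⟩ := (hCg _).1 (accept f)
      exact Finset.mem_biUnion.2 ⟨i, Finset.mem_univ _,
        Finset.mem_filter.2 ⟨Finset.mem_univ _, hi⟩⟩
    simpa using (Finset.card_le_card hu).trans Finset.card_biUnion_le
  have hsum : N ^ D * N ^ (d + 1) ≤ N ^ D * (s' * (K * k ^ (d + 1))) := by
    calc _ ≤ (∑ i, (G i).card) * N ^ (d + 1) := Nat.mul_le_mul_right _ hcover
      _ = ∑ i, (G i).card * N ^ (d + 1) := Finset.sum_mul _ _ _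
      _ ≤ ∑ _i : Fin s', K * (k ^ (d + 1) * N ^ D) := Finset.sum_le_sum fun i _ => hGcard i
      _ = _ := by
        simp only [Finset.sum_const, Finset.card_univ, Fintype.card_fin, smul_eq_mul]
        ring
  have hNpos : 0 < N := Nat.succ_pos _
  have hpow := Nat.le_of_mul_le_mul_left hsum (pow_pos hNpos D)
  have hlen' : L.length + 1 ≤ N * (D * m + 1) := by
    rw [Fintype.card_fin] at hlen
    nlinarith
  have hs : s' ≤ c * (N * (D * m + 1)) ^ d :=
    hs'.trans (Nat.mul_le_mul_left _ (Nat.pow_le_pow_left hlen' d))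
  have hfinal : N ^ d * N ≤ N ^ d * (c * (D * m + 1) ^ d * K * k ^ (d + 1)) := by
    calc N ^ d * N = N ^ (d + 1) := (pow_succ _ _).symm
      _ ≤ s' * (K * k ^ (d + 1)) := hpow
      _ ≤ c * (N * (D * m + 1)) ^ d * (K * k ^ (d + 1)) := Nat.mul_le_mul_right _ hs
      _ = _ := by rw [mul_pow]; ring
  have := Nat.le_of_mul_le_mul_left hfinal (pow_pos hNpos d)
  omega
end

section
/- Let A be an alphabet and L a regular language over A possessing a neutral letter. Suppose there exist lists u, v : List A such that v is a sublist of u, u ++ u ~_L u, and ¬(u ≼_L u ++ v ++ u). Then L is not recognized by any Σ₂ circuit family. (This is the Neutral Straubing Property for Σ₂ in circuit form: a regular language with a neutral letter whose ordered syntactic monoid violates the Σ₂[<] equations x ≤ x·y·x, for x idempotent and y a subword of x, is not recognized by polynomial-size depth-3 circuits of bounded top fan-in.) -/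
/-- The syntactic preorder of `L`: `u ≼_L v` iff every context accepting `u` accepts `v`. -/
def PrecL {A : Type*} (L : Language A) (u v : List A) : Prop :=
  ∀ p q : List A, p ++ u ++ q ∈ L → p ++ v ++ q ∈ L

/-- Syntactic equivalence: `u ~_L v`. -/
def EquivL {A : Type*} (L : Language A) (u v : List A) : Prop :=
  PrecL L u v ∧ PrecL L v u

/-- A letter `e` is neutral for `L`. -/
def IsNeutral {A : Type*} (L : Language A) (e : A) : Prop :=
  ∀ u v : List A, u ++ [e] ++ v ∈ L ↔ u ++ v ∈ L

section Cylinders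

variable {ι V : Type*}

open Classical in
/-- The members of `F` that agree with `a` on `J`. -/
noncomputable def agreeing (F : Finset (ι → V)) (J : Finset ι) (a : ι → V) : Finset (ι → V) :=
  {f ∈ F | ∀ i ∈ J, f i = a i}

theorem mem_agreeing {F : Finset (ι → V)} {J : Finset ι} {a f : ι → V} :
    f ∈ agreeing F J a ↔ f ∈ F ∧ ∀ i ∈ J, f i = a i := by
  simp [agreeing]

variable [Fintype ι] [Fintype V]

theorem card_agreeing_mul_pow_le (F : Finset (ι → V)) (J : Finset ι) (a : ι → V) :
    (agreeing F J a).card * Fintype.card V ^ J.card ≤ Fintype.card V ^ Fintype.card ι := by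
  classical
  have hsub : agreeing F J a ⊆ Fintype.piFinset fun i => if i ∈ J then {a i} else Finset.univ := by
    intro f hf
    rw [Fintype.mem_piFinset]
    intro i
    by_cases hi : i ∈ J
    · simp [hi, (mem_agreeing.1 hf).2 i hi]
    · simp [hi]
  have hpow : Fintype.card V ^ J.card = ∏ i : ι, if i ∈ J then Fintype.card V else 1 := by
    simp [Finset.prod_ite_mem]
  calc (agreeing F J a).card * Fintype.card V ^ J.card
      ≤ (∏ i : ι, (if i ∈ J then {a i} else Finset.univ : Finset V).card) *
          ∏ i : ι, if i ∈ J then Fintype.card V else 1 := by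
        rw [← Fintype.card_piFinset, hpow]
        exact Nat.mul_le_mul_right _ (Finset.card_le_card hsub)
    _ = ∏ _i : ι, Fintype.card V := by
        rw [← Finset.prod_mul_distrib]
        refine Finset.prod_congr rfl fun i _ => ?_
        by_cases hi : i ∈ J <;> simp [hi]
    _ = _ := by simp

/-- Fixing as many coordinates of `F` as possible while losing little density leaves a family in
which no further cylinder is dense. -/
theorem exists_spread_agreeing {F : Finset (ι → V)} (hF : F.Nonempty) (c : ℕ) :
    ∃ (J : Finset ι) (b : ι → V), F.card ≤ (agreeing F J b).card * c ^ J.card ∧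
      ∀ (Q : Finset ι) (a : ι → V), Disjoint Q J →
        (agreeing (agreeing F J b) Q a).card * c ^ Q.card * c ^ J.card
          ≤ (agreeing F J b).card * c ^ J.card := by
  classical
  obtain ⟨f₀, hf₀⟩ := hF
  obtain ⟨⟨J, b⟩, -, hmax⟩ := Finset.exists_max_image
    (Finset.univ : Finset (Finset ι × (ι → V)))
    (fun x => (agreeing F x.1 x.2).card * c ^ x.1.card) ⟨(∅, f₀), Finset.mem_univ _⟩
  refine ⟨J, b, ?_, fun Q a hQ => ?_⟩
  · have hempty : agreeing F ∅ f₀ = F := by ext; simp [mem_agreeing]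
    simpa [hempty] using hmax (∅, f₀) (Finset.mem_univ _)
  · have hunion : agreeing (agreeing F J b) Q a ⊆
        agreeing F (Q ∪ J) (fun i => if i ∈ J then b i else a i) := by
      intro f hf
      simp only [mem_agreeing] at hf ⊢
      refine ⟨hf.1.1, fun i hi => ?_⟩
      by_cases hiJ : i ∈ J
      · simp [hiJ, hf.1.2 i hiJ]
      · simp [hiJ, hf.2 i ((Finset.mem_union.1 hi).resolve_right hiJ)]
    have h := hmax (Q ∪ J, fun i => if i ∈ J then b i else a i) (Finset.mem_univ _)
    simp only [Finset.card_union_of_disjoint hQ, pow_add, ← mul_assoc] at h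
    exact le_trans (by gcongr) h

/-- Some member of `G` has, on every set of coordinates, a pattern that is not rare in `G`. -/
theorem exists_popular {G : Finset (ι → V)} (hG : G.Nonempty) :
    ∃ a ∈ G, ∀ Q : Finset ι,
      G.card ≤ (agreeing G Q a).card * Fintype.card V ^ Q.card * (2 ^ Fintype.card ι + 1) := by
  classical
  by_contra! hcon
  set C := 2 ^ Fintype.card ι + 1 with hC
  let bad (Q : Finset ι) : Finset (ι → V) :=
    {a ∈ G | (agreeing G Q a).card * Fintype.card V ^ Q.card * C < G.card}
  have hbad (Q : Finset ι) : (bad Q).card * C ≤ G.card := by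
    have hV : 0 < Fintype.card V ^ Q.card := by
      obtain ⟨f, -⟩ := hG
      rcases Q.eq_empty_or_nonempty with rfl | ⟨i, -⟩
      · simp
      · exact Nat.pow_pos (Fintype.card_pos_iff.2 ⟨f i⟩)
    let res : (ι → V) → (Q → V) := fun f i => f i
    have hcard : ((bad Q).image res).card ≤ Fintype.card V ^ Q.card := by
      refine (Finset.card_le_univ _).trans ?_
      simp
    have hfib : ∀ y ∈ (bad Q).image res,
        ((bad Q).filter fun f => res f = y).card * (Fintype.card V ^ Q.card * C) ≤ G.card := by
      intro y hy
      obtain ⟨a, ha, rfl⟩ := Finset.mem_image.1 hy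
      refine le_trans ?_ (Finset.mem_filter.1 ha).2.le
      rw [← mul_assoc]
      gcongr
      intro f hf
      simp only [Finset.mem_filter, bad] at hf
      exact mem_agreeing.2 ⟨hf.1.1, fun i hi => congrFun hf.2 ⟨i, hi⟩⟩
    have h : (bad Q).card * (Fintype.card V ^ Q.card * C) ≤ Fintype.card V ^ Q.card * G.card := by
      rw [Finset.card_eq_sum_card_image res (bad Q), Finset.sum_mul]
      refine (Finset.sum_le_card_nsmul _ _ _ hfib).trans ?_
      rw [smul_eq_mul]
      gcongr
    refine Nat.le_of_mul_le_mul_left ?_ hV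
    calc _ = (bad Q).card * (Fintype.card V ^ Q.card * C) := by ring
      _ ≤ _ := h
  have hcover : G ⊆ Finset.univ.biUnion bad := by
    intro a ha
    obtain ⟨Q, hQ⟩ := hcon a ha
    exact Finset.mem_biUnion.2 ⟨Q, Finset.mem_univ _, Finset.mem_filter.2 ⟨ha, hQ⟩⟩
  have h1 : G.card * C ≤ 2 ^ Fintype.card ι * G.card := by
    calc G.card * C ≤ (∑ Q, (bad Q).card) * C :=
          Nat.mul_le_mul_right _ ((Finset.card_le_card hcover).trans Finset.card_biUnion_le)
      _ = ∑ Q, (bad Q).card * C := Finset.sum_mul ..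
      _ ≤ ∑ _Q : Finset ι, G.card := Finset.sum_le_sum fun Q _ => hbad Q
      _ = _ := by simp
  have := hG.card_pos
  rw [hC] at h1
  nlinarith

/-- A dense family of words over a large alphabet leaves few coordinates fixed, and admits a point
`a` such that the partial point obtained by erasing any set of unfixed coordinates is matched by
the family on any `k` tests of whether coordinate `i` equals `x`. -/
theorem exists_matching_of_erasure {F : Finset (ι → V)} (hF : F.Nonempty) {k B : ℕ}
    (hV : Fintype.card V = B ^ (k + 2)) (hB : k * (2 ^ Fintype.card ι + 1) < B) :
    ∃ (J : Finset ι) (a : ι → V),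
      B ^ J.card * F.card ≤ Fintype.card V ^ Fintype.card ι ∧
      ∀ (S : Set ι), Disjoint S J → ∀ K : Finset (ι × V), K.card ≤ k →
        ∃ f ∈ F, ∀ x ∈ K, f x.1 = x.2 ↔ x.1 ∉ S ∧ a x.1 = x.2 := by
  classical
  have hB0 : 0 < B := by omega
  obtain ⟨J, b, hJ, hspread⟩ := exists_spread_agreeing hF (B ^ (k + 1))
  set G := agreeing F J b with hGdef
  have hG : G.Nonempty := by
    rw [Finset.nonempty_iff_ne_empty]
    intro h
    rw [h, Finset.card_empty, zero_mul] at hJ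
    exact absurd hF.card_pos (by omega)
  obtain ⟨a, haG, ha⟩ := exists_popular hG
  refine ⟨J, a, ?_, fun S hS K hK => ?_⟩
  · calc B ^ J.card * F.card ≤ B ^ J.card * (G.card * (B ^ (k + 1)) ^ J.card) := by gcongr
      _ = G.card * Fintype.card V ^ J.card := by rw [hV]; ring
      _ ≤ _ := card_agreeing_mul_pow_le F J b
  · set C := 2 ^ Fintype.card ι + 1
    let Q : Finset ι := (K.image Prod.fst).filter fun i => i ∉ S ∧ i ∉ J ∧ (i, a i) ∈ K
    have hQk : Q.card ≤ k :=
      (Finset.card_filter_le _ _).trans (Finset.card_image_le.trans hK)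
    set H := agreeing G Q a with hH
    have hHG := ha Q
    have hHpos : 0 < H.card := by
      refine Nat.pos_of_ne_zero fun h => ?_
      rw [← hH, h, zero_mul, zero_mul] at hHG
      exact absurd hG.card_pos (by omega)
    let hit (x : ι × V) : Finset (ι → V) := {f ∈ H | f x.1 = x.2}
    have hhit : ∀ x ∈ K.filter fun x => x.1 ∉ Q ∧ x.1 ∉ J, (hit x).card * B ≤ H.card * C := by
      intro x hx
      obtain ⟨-, hxQ, hxJ⟩ := Finset.mem_filter.1 hx
      have hdisj : Disjoint (insert x.1 Q) J := by
        rw [Finset.disjoint_left]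
        intro i hi
        rcases Finset.mem_insert.1 hi with rfl | hi
        · exact hxJ
        · exact (Finset.mem_filter.1 hi).2.2.1
      have h := hspread (insert x.1 Q) (Function.update a x.1 x.2) hdisj
      have h' := Nat.le_of_mul_le_mul_right h (by positivity)
      rw [Finset.card_insert_of_notMem hxQ] at h'
      have hsub : hit x ⊆ agreeing G (insert x.1 Q) (Function.update a x.1 x.2) := by
        intro f hf
        obtain ⟨hfH, hfx⟩ := Finset.mem_filter.1 hf
        obtain ⟨hfG, hfQ⟩ := mem_agreeing.1 hfH
        refine mem_agreeing.2 ⟨hfG, fun i hi => ?_⟩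
        by_cases hix : i = x.1
        · subst hix; simpa using hfx
        · rw [Function.update_of_ne hix]
          exact hfQ i ((Finset.mem_insert.1 hi).resolve_left hix)
      have hpow : B * Fintype.card V ^ Q.card ≤ (B ^ (k + 1)) ^ (Q.card + 1) := by
        rw [hV, ← pow_mul, ← pow_mul, ← pow_succ']
        exact Nat.pow_le_pow_right hB0 (by nlinarith)
      refine Nat.le_of_mul_le_mul_right ?_ (show 0 < Fintype.card V ^ Q.card by rw [hV]; positivity)
      calc (hit x).card * B * Fintype.card V ^ Q.card
          = (hit x).card * (B * Fintype.card V ^ Q.card) := by ring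
        _ ≤ (agreeing G (insert x.1 Q) (Function.update a x.1 x.2)).card *
              (B ^ (k + 1)) ^ (Q.card + 1) := by
            exact Nat.mul_le_mul (Finset.card_le_card hsub) hpow
        _ ≤ G.card := h'
        _ ≤ _ := hHG
        _ = _ := by ring
    obtain ⟨f, hfH, hf⟩ : ∃ f ∈ H, ∀ x ∈ K, x.1 ∉ Q → x.1 ∉ J → f x.1 ≠ x.2 := by
      by_contra! hcon
      have hcover : H ⊆ (K.filter fun x => x.1 ∉ Q ∧ x.1 ∉ J).biUnion hit := by
        intro f hf
        obtain ⟨x, hx, hxQ, hxJ, hfx⟩ := hcon f hf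
        exact Finset.mem_biUnion.2 ⟨x, Finset.mem_filter.2 ⟨hx, hxQ, hxJ⟩,
          Finset.mem_filter.2 ⟨hf, hfx⟩⟩
      have h1 : H.card * B ≤ k * (H.card * C) := by
        calc H.card * B ≤ (∑ x ∈ K.filter fun x => x.1 ∉ Q ∧ x.1 ∉ J, (hit x).card) * B :=
              Nat.mul_le_mul_right _ ((Finset.card_le_card hcover).trans Finset.card_biUnion_le)
          _ = ∑ x ∈ K.filter fun x => x.1 ∉ Q ∧ x.1 ∉ J, (hit x).card * B := Finset.sum_mul ..
          _ ≤ _ := Finset.sum_le_card_nsmul _ _ _ hhit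
          _ ≤ k * (H.card * C) := by
              rw [smul_eq_mul]
              exact Nat.mul_le_mul_right _ ((Finset.card_filter_le _ _).trans hK)
      have h2 : H.card * (k * C) < H.card * B := Nat.mul_lt_mul_of_pos_left hB hHpos
      have h3 : k * (H.card * C) = H.card * (k * C) := by ring
      omega
    obtain ⟨hfG, hfQ⟩ := mem_agreeing.1 hfH
    obtain ⟨hfF, hfJ⟩ := mem_agreeing.1 hfG
    refine ⟨f, hfF, fun x hx => ?_⟩
    by_cases hxJ : x.1 ∈ J
    · have hxS : x.1 ∉ S := fun h => Set.disjoint_left.1 hS h hxJ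
      rw [hfJ _ hxJ, (mem_agreeing.1 haG).2 _ hxJ]
      simp [hxS]
    by_cases hxQ : x.1 ∈ Q
    · rw [hfQ _ hxQ]
      simp [(Finset.mem_filter.1 hxQ).2.1]
    · refine iff_of_false (hf x hx hxQ hxJ) fun h => hxQ ?_
      refine Finset.mem_filter.2 ⟨Finset.mem_image_of_mem _ hx, h.1, hxJ, ?_⟩
      rw [h.2]
      exact hx

end Cylinders

section Words

variable {A : Type*} {L : Language A} {e : A}

theorem EquivL.refl (L : Language A) (u : List A) : EquivL L u u :=
  ⟨fun _ _ h => h, fun _ _ h => h⟩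

theorem EquivL.trans {u v w : List A} (h₁ : EquivL L u v) (h₂ : EquivL L v w) : EquivL L u w :=
  ⟨fun p q h => h₂.1 p q (h₁.1 p q h), fun p q h => h₁.2 p q (h₂.2 p q h)⟩

theorem EquivL.mem_iff {u v : List A} (h : EquivL L u v) (p q : List A) :
    p ++ u ++ q ∈ L ↔ p ++ v ++ q ∈ L :=
  ⟨h.1 p q, h.2 p q⟩

theorem PrecL.append {u u' v v' : List A} (h : PrecL L u u') (h' : PrecL L v v') :
    PrecL L (u ++ v) (u' ++ v') := by
  intro p q hp
  have h₁ := h p (v ++ q) (by simpa using hp)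
  have h₂ := h' (p ++ u') q (by simpa using h₁)
  simpa using h₂

theorem EquivL.append {u u' v v' : List A} (h : EquivL L u u') (h' : EquivL L v v') :
    EquivL L (u ++ v) (u' ++ v') :=
  ⟨h.1.append h'.1, h.2.append h'.2⟩

theorem EquivL.flatMap {κ : Type*} {f g : κ → List A} (l : List κ)
    (h : ∀ x ∈ l, EquivL L (f x) (g x)) : EquivL L (l.flatMap f) (l.flatMap g) := by
  induction l with
  | nil => exact EquivL.refl L _
  | cons x l ih =>
    rw [List.flatMap_cons, List.flatMap_cons]
    exact (h x (by simp)).append (ih fun y hy => h y (by simp [hy]))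

theorem EquivL.flatMap_const {κ : Type*} {u : List A} (hu : EquivL L (u ++ u) u) (l : List κ) :
    EquivL L (u ++ l.flatMap fun _ => u) u := by
  induction l with
  | nil => simpa using EquivL.refl L u
  | cons x l ih =>
    rw [List.flatMap_cons, ← List.append_assoc]
    exact (hu.append (EquivL.refl L _)).trans ih

theorem EquivL.flatMap_const' {κ : Type*} {u : List A} (hu : EquivL L (u ++ u) u) (l : List κ) :
    EquivL L ((l.flatMap fun _ => u) ++ u) u := by
  induction l with
  | nil => simpa using EquivL.refl L u
  | cons x l ih =>
    rw [List.flatMap_cons, List.append_assoc]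
    exact ((EquivL.refl L _).append ih).trans hu

theorem IsNeutral.equivL_replicate (he : IsNeutral L e) (n : ℕ) :
    EquivL L (List.replicate n e) [] := by
  induction n with
  | zero => exact EquivL.refl L _
  | succ n ih =>
    have h1 : EquivL L [e] [] :=
      ⟨fun p q h => by simpa using (he p q).1 h, fun p q h => (he p q).2 (by simpa using h)⟩
    simpa [List.replicate_succ] using h1.append ih

/-- A block of `M` letters: all equal to `e`, except for an `x` at the position given by `o`. -/
def paddedLetter (e : A) (M : ℕ) (x : A) : Option (Fin M) → List A
  | none => List.replicate M e
  | some b => (List.replicate M e).set b x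

theorem length_paddedLetter (M : ℕ) (x : A) (o : Option (Fin M)) :
    (paddedLetter e M x o).length = M := by
  cases o <;> simp [paddedLetter]

theorem equivL_paddedLetter_none (he : IsNeutral L e) (M : ℕ) (x : A) :
    EquivL L (paddedLetter e M x none) [] :=
  he.equivL_replicate M

theorem equivL_paddedLetter_some (he : IsNeutral L e) {M : ℕ} (x : A) (b : Fin M) :
    EquivL L (paddedLetter e M x (some b)) [x] := by
  rw [paddedLetter, List.set_eq_take_append_cons_drop, if_pos (by simp), List.take_replicate,
    List.drop_replicate]
  exact (he.equivL_replicate _).append ((EquivL.refl L [x]).append (he.equivL_replicate _))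

theorem getElem?_paddedLetter_congr {M : ℕ} (x : A) {j : ℕ} (hj : j < M) {o o' : Option (Fin M)}
    (h : o = some ⟨j, hj⟩ ↔ o' = some ⟨j, hj⟩) :
    (paddedLetter e M x o)[j]? = (paddedLetter e M x o')[j]? := by
  have key : ∀ o : Option (Fin M), (paddedLetter e M x o)[j]? =
      some (if o = some ⟨j, hj⟩ then x else e) := by
    rintro (_ | b)
    · simp [paddedLetter, hj]
    · by_cases hb : (b : ℕ) = j
      · subst hb; simp [paddedLetter]
      · have : b ≠ ⟨j, hj⟩ := fun h => hb (by simp [h])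
        simp [paddedLetter, hb, hj, this]
  simp [key, h]

/-- The concatenation of the padded letters `x i`, for `i` in `l`, at positions given by `g`. -/
def paddedWord {κ : Type*} (e : A) (M : ℕ) (x : κ → A) (l : List κ) (g : κ → Option (Fin M)) :
    List A :=
  l.flatMap fun i => paddedLetter e M (x i) (g i)

theorem length_paddedWord {κ : Type*} (M : ℕ) (x : κ → A) (l : List κ)
    (g : κ → Option (Fin M)) : (paddedWord e M x l g).length = l.length * M := by
  simp [paddedWord, List.length_flatMap, length_paddedLetter]

/-- Each letter of a padded word depends on at most one test of whether letter `i` is at position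
`b`. -/
theorem exists_test_paddedWord {κ : Type*} (e : A) (M : ℕ) (x : κ → A) (l : List κ) (j : ℕ) :
    ∃ K : Finset (κ × Fin M), K.card ≤ 1 ∧ ∀ g g' : κ → Option (Fin M),
      (∀ t ∈ K, g t.1 = some t.2 ↔ g' t.1 = some t.2) →
      (paddedWord e M x l g)[j]? = (paddedWord e M x l g')[j]? := by
  induction l generalizing j with
  | nil => exact ⟨∅, by simp, fun _ _ _ => rfl⟩
  | cons i l ih =>
    simp only [paddedWord, List.flatMap_cons]
    by_cases hjM : j < M
    · refine ⟨{(i, ⟨j, hjM⟩)}, by simp, fun g g' h => ?_⟩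
      rw [List.getElem?_append_left (by rwa [length_paddedLetter]),
        List.getElem?_append_left (by rwa [length_paddedLetter])]
      exact getElem?_paddedLetter_congr _ hjM (by simpa using h)
    · obtain ⟨K, hK, h⟩ := ih (j - M)
      refine ⟨K, hK, fun g g' hg => ?_⟩
      rw [List.getElem?_append_right (by rw [length_paddedLetter]; omega),
        List.getElem?_append_right (by rw [length_paddedLetter]; omega),
        length_paddedLetter, length_paddedLetter]
      exact h g g' hg

theorem exists_test_append_paddedWord_append {κ : Type*} (e : A) (M : ℕ) (x : κ → A) (l : List κ)
    (p q : List A) (j : ℕ) :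
    ∃ K : Finset (κ × Fin M), K.card ≤ 1 ∧ ∀ g g' : κ → Option (Fin M),
      (∀ t ∈ K, g t.1 = some t.2 ↔ g' t.1 = some t.2) →
      (p ++ paddedWord e M x l g ++ q)[j]? = (p ++ paddedWord e M x l g' ++ q)[j]? := by
  obtain ⟨K, hK, h⟩ := exists_test_paddedWord e M x l (j - p.length)
  refine ⟨K, hK, fun g g' hg => ?_⟩
  simp only [List.append_assoc, List.getElem?_append, length_paddedWord, h g g' hg]

theorem equivL_paddedWord (he : IsNeutral L e) {κ : Type*} {M : ℕ} (x : κ → A) (l : List κ)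
    (g : κ → Option (Fin M)) :
    EquivL L (paddedWord e M x l g) ((l.filter fun i => (g i).isSome).map x) := by
  induction l with
  | nil => exact EquivL.refl L _
  | cons i l ih =>
    rw [paddedWord, List.flatMap_cons, ← paddedWord]
    rcases hg : g i with _ | b
    · simpa [hg] using (equivL_paddedLetter_none he M (x i)).append ih
    · simpa [hg] using (equivL_paddedLetter_some he (x i) b).append ih

theorem List.Sublist.eq_filter_of_nodup {κ : Type*} [DecidableEq κ] {l' l : List κ}
    (h : l'.Sublist l) (hl : l.Nodup) : l' = l.filter (· ∈ l') := by
  induction h with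
  | slnil => rfl
  | @cons l' l a h ih =>
    rw [List.nodup_cons] at hl
    have ha : a ∉ l' := fun ha => hl.1 (h.subset ha)
    simpa [List.filter_cons, ha] using ih hl.2
  | @cons_cons l' l a h ih =>
    rw [List.nodup_cons] at hl
    rw [List.filter_cons_of_pos (by simp)]
    refine congrArg (a :: ·) ((ih hl.2).trans (List.filter_congr fun x hx => ?_))
    have hxa : x ≠ a := fun h => hl.1 (h ▸ hx)
    simp [hxa]

theorem List.Sublist.exists_filter_finRange {u v : List A} (h : v.Sublist u) :
    ∃ T : Fin u.length → Bool, v = ((List.finRange u.length).filter T).map u.get := by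
  rw [← List.map_get_finRange u, List.sublist_map_iff] at h
  obtain ⟨l', hl', rfl⟩ := h
  exact ⟨(· ∈ l'), congrArg _ (hl'.eq_filter_of_nodup (List.nodup_finRange _))⟩

/-- A padded word with `N` rows, each spelling `u` except row `t`, which spells `v`, is equivalent
to `u ++ v ++ u` once surrounded by copies of the idempotent `u`. -/
theorem equivL_rows {u v : List A} (hu : EquivL L (u ++ u) u) {N : ℕ} (t : Fin N) :
    EquivL L (u ++ ((List.finRange N).flatMap fun s => if s = t then v else u) ++ u)
      (u ++ v ++ u) := by
  obtain ⟨l₁, l₂, hl⟩ := List.append_of_mem (List.mem_finRange t)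
  have hnd := List.nodup_finRange N
  rw [hl, List.nodup_middle, List.nodup_cons, List.mem_append, not_or] at hnd
  have hconst : ∀ l : List (Fin N), t ∉ l →
      (l.flatMap fun s => if s = t then v else u) = l.flatMap fun _ => u := by
    intro l ht
    refine List.flatMap_congr fun s hs => if_neg ?_
    rintro rfl
    exact ht hs
  rw [hl, List.flatMap_append, List.flatMap_cons, hconst l₁ hnd.1.1, hconst l₂ hnd.1.2, if_pos rfl]
  simpa using ((EquivL.flatMap_const hu l₁).append (EquivL.refl L v)).append
    (EquivL.flatMap_const' hu l₂)

/-- The row-by-row enumeration of `Fin N × Fin m`. -/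
def rowsList (N m : ℕ) : List (Fin N × Fin m) :=
  (List.finRange N).flatMap fun t => (List.finRange m).map fun s => (t, s)

theorem length_rowsList (N m : ℕ) : (rowsList N m).length = N * m := by
  simp [rowsList, List.length_flatMap]

theorem equivL_paddedWord_rowsList (he : IsNeutral L e) {u : List A} {M N : ℕ}
    (g : Fin N × Fin u.length → Option (Fin M)) (r : Fin N → List A)
    (hr : ∀ t, ((List.finRange u.length).filter fun s => (g (t, s)).isSome).map u.get = r t) :
    EquivL L (paddedWord e M (fun i => u.get i.2) (rowsList N u.length) g)
      ((List.finRange N).flatMap r) := by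
  rw [paddedWord, rowsList, List.flatMap_assoc]
  refine EquivL.flatMap _ fun t _ => ?_
  rw [← hr t, List.flatMap_map]
  exact equivL_paddedWord he u.get (List.finRange u.length) fun s => g (t, s)

theorem List.exists_ofFn_eq {l : List A} {n : ℕ} (h : l.length = n) :
    ∃ w : Fin n → A, List.ofFn w = l := by
  subst h
  exact ⟨l.get, List.ofFn_get l⟩

end Words

/-- Neutral Straubing Property for Σ₂, circuit form: a regular language with a
neutral letter violating the Σ₂[<] equation `x ≤ x·y·x` (for `x` idempotent and
`y` a subword of `x`) is not recognized by a Σ₂ circuit family. -/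
theorem neutral_straubing_sigma2 {A : Type*} (L : Language A)
    (hreg : L.IsRegular) (hneutral : ∃ e : A, IsNeutral L e)
    (u v : List A) (hsub : v.Sublist u)
    (hidem : EquivL L (u ++ u) u) (hviol : ¬ PrecL L u (u ++ v ++ u)) :
    ¬ RecSigma2 L := by
  rintro ⟨k, c, d, hrec⟩
  obtain ⟨e, he⟩ := hneutral
  simp only [PrecL, not_forall] at hviol
  obtain ⟨p, q, hpu, hpv⟩ := hviol
  obtain ⟨T, hT⟩ := hsub.exists_filter_finRange
  have hget := List.map_get_finRange u
  set N := (k + 2) * d + 1 with hN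
  set D := N * u.length with hD
  set c₀ := (p ++ u).length + (u ++ q).length + 1 with hc₀
  set B := k * (2 ^ D + 1) + c * (c₀ + D) ^ d + 1 with hB
  set M := B ^ (k + 2) with hM
  have hB0 : 0 < B := by omega
  have hM0 : 0 < M := by positivity
  set n := (p ++ u).length + D * M + (u ++ q).length with hn
  let W (g : Fin N × Fin u.length → Option (Fin M)) : List A :=
    (p ++ u) ++ paddedWord e M (fun i => u.get i.2) (rowsList N u.length) g ++ (u ++ q)
  have hWlen : ∀ g, (W g).length = n := by
    intro g
    rw [List.length_append, List.length_append (as := p ++ u), length_paddedWord, length_rowsList]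
  choose w hw using fun g => List.exists_ofFn_eq (hWlen g)
  obtain ⟨C, ⟨s, hs, I, φ, hφ, hCφ⟩, hC⟩ := hrec n
  have hrows : ∀ g (r : Fin N → List A),
      (∀ t, ((List.finRange u.length).filter fun i => (g (t, i)).isSome).map u.get = r t) →
      (C (w g) ↔ p ++ (u ++ (List.finRange N).flatMap r ++ u) ++ q ∈ L) := by
    intro g r hr
    rw [hC, hw]
    have h := (equivL_paddedWord_rowsList he g r hr).mem_iff (p ++ u) (u ++ q)
    simpa [W] using h
  have hfull : ∀ f : Fin N × Fin u.length → Fin M, C (w fun i => some (f i)) := by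
    intro f
    refine (hrows _ (fun _ => u) fun t => by simp [hget]).2 ?_
    have h := ((EquivL.flatMap_const hidem (List.finRange N)).append (EquivL.refl L u)).trans hidem
    exact (h.mem_iff p q).2 hpu
  choose sel hsel using fun f => (hCφ _).1 (hfull f)
  obtain ⟨i₀, hi₀⟩ : ∃ i₀ : Fin s,
      M ^ D ≤ s * (Finset.univ.filter fun f => sel f = i₀).card := by
    have hne : (Finset.univ : Finset (Fin s)).Nonempty := ⟨sel fun _ => ⟨0, hM0⟩, Finset.mem_univ _⟩
    obtain ⟨i, -, hi⟩ := Finset.exists_le_of_sum_le hne (f := fun _ => M ^ D)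
      (g := fun i => s * (Finset.univ.filter fun f => sel f = i).card) (by
        rw [← Finset.mul_sum, ← Finset.card_eq_sum_card_fiberwise (fun _ _ => Finset.mem_univ _)]
        simp [hD])
    exact ⟨i, hi⟩
  set F := Finset.univ.filter fun f => sel f = i₀
  have hMD : 0 < M ^ D := by positivity
  have hF0 : 0 < F.card := Nat.pos_of_ne_zero fun h => by
    rw [h, mul_zero] at hi₀
    omega
  have hcard : Fintype.card (Fin N × Fin u.length) = D := by simp [hD]
  obtain ⟨J, a, hJ, hmatch⟩ := exists_matching_of_erasure (Finset.card_pos.1 hF0) (k := k) (B := B)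
    (by simp [hM]) (by rw [hcard]; omega)
  have hJs : B ^ J.card ≤ s := by
    refine Nat.le_of_mul_le_mul_right (hJ.trans ?_) hF0
    rw [hcard, Fintype.card_fin]
    exact hi₀
  have hJN : J.card < N := by
    by_contra! hcon
    have hn1 : n + 1 ≤ (c₀ + D) * M := by
      rw [add_mul]
      have : c₀ ≤ c₀ * M := Nat.le_mul_of_pos_right _ hM0
      omega
    have h : B * B ^ ((k + 2) * d) ≤ c * (c₀ + D) ^ d * B ^ ((k + 2) * d) := by
      calc B * B ^ ((k + 2) * d) = B ^ N := by rw [hN, pow_succ']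
        _ ≤ B ^ J.card := Nat.pow_le_pow_right hB0 hcon
        _ ≤ c * (n + 1) ^ d := hJs.trans hs
        _ ≤ c * ((c₀ + D) * M) ^ d := by gcongr
        _ = _ := by rw [mul_pow, hM, ← pow_mul, mul_assoc]
    have := Nat.le_of_mul_le_mul_right h (by positivity)
    omega
  obtain ⟨t, -, ht⟩ : ∃ t ∈ (Finset.univ : Finset (Fin N)), t ∉ J.image Prod.fst :=
    Finset.exists_mem_notMem_of_card_lt_card
      (by simpa using Finset.card_image_le.trans_lt hJN)
  let S : Set (Fin N × Fin u.length) := {i | i.1 = t ∧ T i.2 = false}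
  have hSJ : Disjoint S J := Set.disjoint_left.2 fun i hi hiJ =>
    ht (Finset.mem_image.2 ⟨i, hiJ, hi.1⟩)
  classical
  let g (i : Fin N × Fin u.length) : Option (Fin M) := if i ∈ S then none else some (a i)
  have hacc : C (w g) := by
    refine (hCφ _).2 ⟨i₀, fun j => ?_⟩
    obtain ⟨P, hPk, hP⟩ := hφ i₀ j
    choose K hK1 hK using exists_test_append_paddedWord_append e M (fun i => u.get i.2)
      (rowsList N u.length) (p ++ u) (u ++ q)
    obtain ⟨f, hfF, hf⟩ := hmatch S hSJ (P.biUnion fun x => K x)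
      ((Finset.card_biUnion_le_card_mul P (fun x => K x) 1 fun x _ => hK1 x).trans
        (by rwa [mul_one]))
    have hfi : sel f = i₀ := (Finset.mem_filter.1 hfF).2
    have hfj : φ i₀ j (w fun i => some (f i)) := (hfi ▸ hsel f : ∀ j, φ i₀ j _) j
    refine (hP _ _ fun x hx => ?_).1 hfj
    have hx' := hK x (fun i => some (f i)) g fun i hi => by
      rw [Option.some_inj, hf i (Finset.mem_biUnion.2 ⟨x, hx, hi⟩)]
      by_cases hiS : i.1 ∈ S <;> simp [g, hiS]
    change (W _)[(x : ℕ)]? = (W g)[(x : ℕ)]? at hx'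
    rw [← hw, ← hw] at hx'
    simpa using hx'
  have hrej := (hrows g (fun s => if s = t then v else u) fun s => by
    by_cases hst : s = t
    · rw [if_pos hst, hT]
      refine congrArg _ (List.filter_congr fun i _ => ?_)
      cases hTi : T i <;> simp [g, S, hst, hTi]
    · simp [g, S, hst, hget]).1 hacc
  exact hpv (((equivL_rows hidem t).mem_iff p q).1 hrej)
end

section
/- A list w over A₃ belongs to the language K if and only if all of the following hold: (1) for all lists p, q, r with w = p ++ [a] ++ q ++ [a] ++ r, the letter b occurs in q; (2) for all lists p, q, r with w = p ++ [b] ++ q ++ [b] ++ r, the letter a occurs in q; (3) there are no lists p, q with w = p ++ [b] ++ q such that every letter of p equals c; (4) there are no lists p, q with w = p ++ [a] ++ q such that every letter of q equals c. (In words: between every two a's there is a b and vice versa, and the first and last non-neutral letters, if any, are a and b respectively.) -/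
/-- Every occurrence of `x` in `w` is preceded by an occurrence of `y`. -/
def PrecededBy {α : Type*} (x y : α) (w : List α) : Prop :=
  ∀ q r : List α, w = q ++ x :: r → y ∈ q

/-- Between any two occurrences of `x` in `w` there is an occurrence of `y`. -/
def SeparatedBy {α : Type*} (x y : α) (w : List α) : Prop :=
  ∀ p q r : List α, w = p ++ [x] ++ q ++ [x] ++ r → y ∈ q

section
variable {α : Type*} {x y z : α} {w : List α}

theorem precededBy_nil : PrecededBy x y [] := by
  simp [PrecededBy]

theorem precededBy_cons :
    PrecededBy x y (z :: w) ↔ z ≠ x ∧ (z = y ∨ PrecededBy x y w) := by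
  constructor
  · intro h
    refine ⟨?_, or_iff_not_imp_left.2 fun hzy q r hw => ?_⟩
    · rintro rfl
      simpa using h [] w rfl
    · have := h (z :: q) r (by simp [hw])
      grind
  · rintro ⟨hzx, h⟩ q r hw
    rcases q with _ | ⟨t, q⟩
    · grind
    · obtain ⟨rfl, rfl⟩ : z = t ∧ w = q ++ x :: r := by simpa using hw
      rcases h with rfl | h
      · simp
      · exact List.mem_cons_of_mem _ (h q r rfl)

theorem separatedBy_nil : SeparatedBy x y [] := by
  simp [SeparatedBy]

theorem separatedBy_cons :
    SeparatedBy x y (z :: w) ↔ (z = x → PrecededBy x y w) ∧ SeparatedBy x y w := by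
  constructor
  · refine fun h => ⟨?_, fun p q r hw => h (z :: p) q r (by simp [hw])⟩
    rintro rfl q r hw
    exact h [] q r (by simp [hw])
  · rintro ⟨h, h'⟩ p q r hw
    rcases p with _ | ⟨t, p⟩
    · obtain ⟨rfl, hw⟩ : z = x ∧ w = q ++ x :: r := by simpa using hw
      exact h rfl q r hw
    · obtain ⟨rfl, rfl⟩ : z = t ∧ w = p ++ x :: (q ++ x :: r) := by simpa using hw
      exact h' p q r (by simp)

/-- No occurrence of `x` in `w` is preceded only by letters `y`. -/
def NotFirst (x y : α) (w : List α) : Prop :=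
  ¬ ∃ p q : List α, w = p ++ [x] ++ q ∧ ∀ t ∈ p, t = y

/-- No occurrence of `x` in `w` is followed only by letters `y`. -/
def NotLast (x y : α) (w : List α) : Prop :=
  ¬ ∃ p q : List α, w = p ++ [x] ++ q ∧ ∀ t ∈ q, t = y

theorem notFirst_nil : NotFirst x y [] := by
  simp [NotFirst]

theorem notFirst_cons :
    NotFirst x y (z :: w) ↔ z ≠ x ∧ (z = y → NotFirst x y w) := by
  constructor
  · refine fun h => ⟨?_, ?_⟩
    · rintro rfl
      exact h ⟨[], w, by simp⟩
    · rintro rfl ⟨p, q, rfl, hp⟩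
      exact h ⟨z :: p, q, by simp, by simpa using hp⟩
  · rintro ⟨hzx, h⟩ ⟨_ | ⟨t, p⟩, q, hw, hp⟩
    · simp_all
    · obtain ⟨rfl, rfl⟩ : z = t ∧ w = p ++ x :: q := by simpa using hw
      exact h (hp z (by simp)) ⟨p, q, by simp, fun t ht => hp t (by simp [ht])⟩

theorem notLast_nil : NotLast x y [] := by
  simp [NotLast]

theorem notLast_cons :
    NotLast x y (z :: w) ↔ (z = x → ¬ ∀ t ∈ w, t = y) ∧ NotLast x y w := by
  constructor
  · refine fun h => ⟨?_, ?_⟩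
    · rintro rfl hw
      exact h ⟨[], w, by simp, hw⟩
    · rintro ⟨p, q, rfl, hq⟩
      exact h ⟨z :: p, q, by simp, hq⟩
  · rintro ⟨h, h'⟩ ⟨_ | ⟨t, p⟩, q, hw, hq⟩
    · obtain ⟨rfl, rfl⟩ : z = x ∧ w = q := by simpa using hw
      exact h rfl hq
    · obtain ⟨rfl, rfl⟩ : z = t ∧ w = p ++ x :: q := by simpa using hw
      exact h' ⟨p, q, by simp, hq⟩

end

theorem eq_la_or_lb_or_lc (x : A₃) : x = la ∨ x = lb ∨ x = lc := by
  revert x; decide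

theorem precededBy_lb_la_iff (w : List A₃) : PrecededBy lb la w ↔ NotFirst lb lc w := by
  induction w with
  | nil => simp [precededBy_nil, notFirst_nil]
  | cons z w ih =>
    rw [precededBy_cons, notFirst_cons, ih]
    rcases eq_la_or_lb_or_lc z with rfl | rfl | rfl <;> simp [la, lb, lc]

/-- The letters `a` and `b` alternate in `w`, starting with `a` and ending with `b`. -/
def Alternating (w : List A₃) : Prop :=
  SeparatedBy la lb w ∧ SeparatedBy lb la w ∧ NotFirst lb lc w ∧ NotLast la lc w

namespace Alternating
variable {w : List A₃}

theorem nil : Alternating [] :=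
  ⟨separatedBy_nil, separatedBy_nil, notFirst_nil, notLast_nil⟩

theorem lc_cons_iff : Alternating (lc :: w) ↔ Alternating w := by
  simp [Alternating, separatedBy_cons, notFirst_cons, notLast_cons, la, lb, lc]

theorem not_lb_cons : ¬ Alternating (lb :: w) := by
  simp [Alternating, notFirst_cons]

theorem not_singleton_la : ¬ Alternating [la] := by
  simp [Alternating, notLast_cons]

theorem not_la_la_cons : ¬ Alternating (la :: la :: w) := by
  simp [Alternating, separatedBy_cons, precededBy_cons]

theorem la_lc_cons_iff : Alternating (la :: lc :: w) ↔ Alternating (la :: w) := by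
  simp [Alternating, separatedBy_cons, precededBy_cons, notFirst_cons, notLast_cons, la, lb, lc]

theorem la_lb_cons_iff : Alternating (la :: lb :: w) ↔ Alternating w := by
  simp only [Alternating, separatedBy_cons, precededBy_cons, notFirst_cons, notLast_cons,
    precededBy_lb_la_iff]
  simp [la, lb, lc]
  tauto

theorem la_replicate_lc_append_iff (n : ℕ) :
    Alternating (la :: (List.replicate n lc ++ w)) ↔ Alternating (la :: w) := by
  induction n with
  | zero => simp
  | succ n ih => rw [List.replicate_succ, List.cons_append, la_lc_cons_iff, ih]

end Alternating

theorem mem_kstar_singleton_iff {α : Type*} {x : α} {w : List α} :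
    w ∈ KStar.kstar ({[x]} : Language α) ↔ ∃ n, w = List.replicate n x := by
  rw [Language.mem_kstar]
  constructor
  · rintro ⟨L, rfl, hL⟩
    refine ⟨L.length, ?_⟩
    rw [List.eq_replicate_of_mem (a := [x]) hL]
    simp
  · rintro ⟨n, rfl⟩
    exact ⟨List.replicate n [x], by simp, fun y hy => List.eq_of_mem_replicate hy⟩

/-- The language of `a·c*·b + c`, of which `K` is the Kleene star. -/
def blockLang : Language A₃ :=
  {[la]} * KStar.kstar {[lc]} * {[lb]} + {[lc]}

theorem Klang_eq_kstar : Klang = KStar.kstar blockLang := by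
  simp [Klang, Kexp, blockLang]

theorem mem_blockLang_iff {w : List A₃} :
    w ∈ blockLang ↔ (∃ n, w = la :: (List.replicate n lc ++ [lb])) ∨ w = [lc] := by
  rw [blockLang, Language.mem_add]
  refine or_congr ?_ Iff.rfl
  constructor
  · rintro ⟨_, ⟨_, rfl, v, hv, rfl⟩, _, rfl, rfl⟩
    obtain ⟨n, rfl⟩ := mem_kstar_singleton_iff.1 hv
    exact ⟨n, by simp⟩
  · rintro ⟨n, rfl⟩
    exact ⟨_, ⟨_, rfl, _, mem_kstar_singleton_iff.2 ⟨n, rfl⟩, rfl⟩, _, rfl, by simp⟩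

theorem append_mem_Klang {u w : List A₃} (hu : u ∈ blockLang) (hw : w ∈ Klang) :
    u ++ w ∈ Klang := by
  rw [Klang_eq_kstar] at *
  rw [← Language.one_add_self_mul_kstar_eq_kstar]
  exact Or.inr ⟨u, hu, w, hw, rfl⟩

theorem alternating_of_mem_Klang {w : List A₃} (hw : w ∈ Klang) : Alternating w := by
  rw [Klang_eq_kstar, Language.mem_kstar] at hw
  obtain ⟨L, rfl, hL⟩ := hw
  induction L with
  | nil => exact .nil
  | cons u L ih =>
    have hrec := ih fun y hy => hL y (by simp [hy])
    rcases mem_blockLang_iff.1 (hL u (by simp)) with ⟨n, rfl⟩ | rfl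
    · simpa [Alternating.la_replicate_lc_append_iff, Alternating.la_lb_cons_iff] using hrec
    · simpa [Alternating.lc_cons_iff] using hrec

theorem mem_Klang_of_alternating_aux (w : List A₃) :
    (Alternating w → w ∈ Klang) ∧
      ∀ n, Alternating (la :: w) → la :: (List.replicate n lc ++ w) ∈ Klang := by
  induction w with
  | nil =>
    refine ⟨fun _ => ?_, fun n h => (Alternating.not_singleton_la h).elim⟩
    rw [Klang_eq_kstar]
    exact Language.nil_mem_kstar _
  | cons z w ih =>
    obtain ⟨ihw, iha⟩ := ih
    rcases eq_la_or_lb_or_lc z with rfl | rfl | rfl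
    · exact ⟨iha 0, fun n h => (Alternating.not_la_la_cons h).elim⟩
    · refine ⟨fun h => (Alternating.not_lb_cons h).elim, fun n h => ?_⟩
      simpa using append_mem_Klang (mem_blockLang_iff.2 (.inl ⟨n, rfl⟩))
        (ihw (Alternating.la_lb_cons_iff.1 h))
    · refine ⟨fun h => append_mem_Klang (mem_blockLang_iff.2 (.inr rfl))
        (ihw (Alternating.lc_cons_iff.1 h)), fun n h => ?_⟩
      simpa [List.replicate_succ'] using iha (n + 1) (Alternating.la_lc_cons_iff.1 h)

/-- Characterization of membership in `K = (a·c*·b + c)*`: between every two `a`s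
there is a `b` and vice versa, and the first (resp. last) non-neutral letter, if
any, is `a` (resp. `b`). -/
theorem mem_K_iff (w : List A₃) :
    w ∈ Klang ↔
      ((∀ p q r : List A₃, w = p ++ [la] ++ q ++ [la] ++ r → lb ∈ q) ∧
       (∀ p q r : List A₃, w = p ++ [lb] ++ q ++ [lb] ++ r → la ∈ q) ∧
       (¬ ∃ p q : List A₃, w = p ++ [lb] ++ q ∧ ∀ x ∈ p, x = lc) ∧
       (¬ ∃ p q : List A₃, w = p ++ [la] ++ q ∧ ∀ x ∈ q, x = lc)) := by
  exact ⟨alternating_of_mem_Klang, (mem_Klang_of_alternating_aux w).1⟩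
end
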